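/- For every integer N ≥ 1, pg(N) ≤ 3207.42^N, i.e., the number of plane graphs on any set of N points in the plane in general position is at most 3207.42^N. -/

import Mathlib

open scoped Classical

noncomputable section

/-- A point in the plane. -/
abbrev Pt : Type := ℝ × ℝ

/-- `S` is in general position: no three distinct points of `S` are collinear. -/
def GenPos (S : Finset Pt) : Prop :=
  ∀ p ∈ S, ∀ q ∈ S, ∀ r ∈ S, p ≠ q → p ≠ r → q ≠ r →
    ¬ Collinear ℝ ({p, q, r} : Set Pt)

/-- Two straight edges cross if their relative interiors (open segments) meet. -/
def EdgesCross (e f : Sym2 Pt) : Prop :=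
  ∃ a b c d : Pt, e = s(a, b) ∧ f = s(c, d) ∧
    (openSegment ℝ a b ∩ openSegment ℝ c d).Nonempty

/-- `G` is a crossing-free straight-edge (plane) graph on the point set `S`:
its edges are nondegenerate straight segments between points of `S`,
and no two distinct edges cross. -/
def IsPlaneGraph (S : Finset Pt) (G : Finset (Sym2 Pt)) : Prop :=
  (∀ e ∈ G, ¬ e.IsDiag ∧ ∀ p ∈ e, p ∈ S) ∧
    ∀ e ∈ G, ∀ f ∈ G, e ≠ f → ¬ EdgesCross e f

/-- The (finite) collection of all plane graphs on `S`. -/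
def planeGraphs (S : Finset Pt) : Finset (Finset (Sym2 Pt)) :=
  S.sym2.powerset.filter (IsPlaneGraph S)

/-- The degree of the point `p` in the graph `G`. -/
def vingDeg (G : Finset (Sym2 Pt)) (p : Pt) : ℕ :=
  (G.filter fun e => p ∈ e).card

/-- The ving `(p, G)` is an x-ving: no straight edge from `p` to another point
of `S` can be added to `G` while keeping the graph plane. -/
def IsXVing (S : Finset Pt) (G : Finset (Sym2 Pt)) (p : Pt) : Prop :=
  ∀ q ∈ S, q ≠ p → s(p, q) ∉ G → ¬ IsPlaneGraph S (insert s(p, q) G)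

/-- `v_x(G)`: the number of x-vings of `G`. -/
def vx (S : Finset Pt) (G : Finset (Sym2 Pt)) : ℕ :=
  (S.filter (IsXVing S G)).card

/-- `v_i(G)`: the number of vertices of degree exactly `i` in `G`. -/
def vdeg (S : Finset Pt) (G : Finset (Sym2 Pt)) (i : ℕ) : ℕ :=
  (S.filter fun p => vingDeg G p = i).card

/-- `ĥv_x(S)`: the average of `v_x(G)` over a uniformly random plane graph on `S`. -/
def hvx (S : Finset Pt) : ℝ :=
  (∑ G ∈ planeGraphs S, (vx S G : ℝ)) / (planeGraphs S).card

/-- `ĥv_i(S)`: the average of `v_i(G)` over a uniformly random plane graph on `S`. -/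
def hvdeg (S : Finset Pt) (i : ℕ) : ℝ :=
  (∑ G ∈ planeGraphs S, (vdeg S G i : ℝ)) / (planeGraphs S).card

/-- `pg(N)`: the maximum number of plane graphs over all sets of `N` points in
general position. -/
def pgMax (N : ℕ) : ℕ :=
  sSup {n : ℕ | ∃ S : Finset Pt, S.card = N ∧ GenPos S ∧ (planeGraphs S).card = n}

/-- The plane graphs on `S` with at most `m` edges. -/
def planeGraphsLE (S : Finset Pt) (m : ℝ) : Finset (Finset (Sym2 Pt)) :=
  (planeGraphs S).filter fun G => (G.card : ℝ) ≤ m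

/-- `ĥv_{x,m}(S)`: the average of `v_x(G)` over a uniformly random plane graph
on `S` with at most `m` edges. -/
def hvxLE (S : Finset Pt) (m : ℝ) : ℝ :=
  (∑ G ∈ planeGraphsLE S m, (vx S G : ℝ)) / (planeGraphsLE S m).card

/-- `G` has no vertex (point of `S`) of degree smaller than `i`. -/
def MinDegGe (S : Finset Pt) (G : Finset (Sym2 Pt)) (i : ℕ) : Prop :=
  ∀ p ∈ S, i ≤ vingDeg G p

/-- The plane graphs on `S` with no vertex of degree smaller than `i`. -/
def planeGraphsDeg (S : Finset Pt) (i : ℕ) : Finset (Finset (Sym2 Pt)) :=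
  (planeGraphs S).filter fun G => MinDegGe S G i

/-- The plane graphs on `S` with at most `m` edges and no vertex of degree
smaller than `i`. -/
def planeGraphsLEDeg (S : Finset Pt) (m : ℝ) (i : ℕ) : Finset (Finset (Sym2 Pt)) :=
  (planeGraphs S).filter fun G => (G.card : ℝ) ≤ m ∧ MinDegGe S G i

/-- `ĥv_{x,m}(S,i)`: the average of `v_x(G)` over a uniformly random plane graph
on `S` with at most `m` edges and no vertex of degree smaller than `i`. -/
def hvxLEDeg (S : Finset Pt) (m : ℝ) (i : ℕ) : ℝ :=
  (∑ G ∈ planeGraphsLEDeg S m i, (vx S G : ℝ)) / (planeGraphsLEDeg S m i).card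

/-- `pg(N, i)`: the maximum, over sets `S` of `N` points in general position, of
the number of plane graphs on `S` with no vertex of degree smaller than `i`. -/
def pgMaxDeg (N i : ℕ) : ℕ :=
  sSup {n : ℕ | ∃ S : Finset Pt, S.card = N ∧ GenPos S ∧ (planeGraphsDeg S i).card = n}

/-- The underlying abstract graph of `G` on the vertex set `S`. -/
def abstractGraph (S : Finset Pt) (G : Finset (Sym2 Pt)) :
    SimpleGraph (S : Set Pt) :=
  SimpleGraph.induce (S : Set Pt) (SimpleGraph.fromEdgeSet (G : Set (Sym2 Pt)))

/-- The connected plane graphs on `S`. -/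
def connPlaneGraphs (S : Finset Pt) : Finset (Finset (Sym2 Pt)) :=
  (planeGraphs S).filter fun G => (abstractGraph S G).Connected

/-- The underlying abstract graph of `G` is bi-connected (2-vertex-connected):
it is connected and remains connected after deletion of any single vertex. -/
def Biconnected (S : Finset Pt) (G : Finset (Sym2 Pt)) : Prop :=
  (abstractGraph S G).Connected ∧
    ∀ v ∈ S, (SimpleGraph.induce ((S : Set Pt) \ {v})
      (SimpleGraph.fromEdgeSet (G : Set (Sym2 Pt)))).Connected

/-- The bi-connected plane graphs on `S`. -/
def biconnPlaneGraphs (S : Finset Pt) : Finset (Finset (Sym2 Pt)) :=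
  (planeGraphs S).filter (Biconnected S)

/-- `G` is a `k`-quasi-plane graph on `S`: a straight-edge graph on `S`
(crossings allowed) with no `k` pairwise crossing edges. -/
def IsQuasiPlane (k : ℕ) (S : Finset Pt) (G : Finset (Sym2 Pt)) : Prop :=
  (∀ e ∈ G, ¬ e.IsDiag ∧ ∀ p ∈ e, p ∈ S) ∧
    ¬ ∃ T ⊆ G, T.card = k ∧ ∀ e ∈ T, ∀ f ∈ T, e ≠ f → EdgesCross e f

/-- The (finite) collection of all `k`-quasi-plane graphs on `S`. -/
def qpGraphs (k : ℕ) (S : Finset Pt) : Finset (Finset (Sym2 Pt)) :=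
  S.sym2.powerset.filter (IsQuasiPlane k S)

/-- The ving `(p, G)` is an x-ving of the `k`-quasi-plane graph `G`: no straight
edge from `p` to another point of `S` can be added to `G` without violating
`k`-quasi-planarity. -/
def IsXVingQP (k : ℕ) (S : Finset Pt) (G : Finset (Sym2 Pt)) (p : Pt) : Prop :=
  ∀ q ∈ S, q ≠ p → s(p, q) ∉ G → ¬ IsQuasiPlane k S (insert s(p, q) G)

/-- `v_x(G)` for a `k`-quasi-plane graph `G`. -/
def vxQP (k : ℕ) (S : Finset Pt) (G : Finset (Sym2 Pt)) : ℕ :=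
  (S.filter (IsXVingQP k S G)).card

/-- `ĥv_x^k(S)`: the average of `v_x(G)` over a uniformly random `k`-quasi-plane
graph on `S`. -/
def hvxQP (k : ℕ) (S : Finset Pt) : ℝ :=
  (∑ G ∈ qpGraphs k S, (vxQP k S G : ℝ)) / (qpGraphs k S).card

/-- `qp_k(N)`: the maximum number of `k`-quasi-plane graphs over all sets of `N`
points in general position. -/
def qpMax (k N : ℕ) : ℕ :=
  sSup {n : ℕ | ∃ S : Finset Pt, S.card = N ∧ GenPos S ∧ (qpGraphs k S).card = n}

section Triangulations

/-- Twice the signed area of the triangle `p a b`. -/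
def orient (p a b : Pt) : ℝ := (a.1 - p.1) * (b.2 - p.2) - (a.2 - p.2) * (b.1 - p.1)

/-- The point dividing the segment from `a` to `b` in the ratio `t : 1 - t`. -/
def lin (t : ℝ) (a b : Pt) : Pt := ((1 - t) * a.1 + t * b.1, (1 - t) * a.2 + t * b.2)

lemma orient_rot (a b c : Pt) : orient b c a = orient a b c := by
  simp only [orient]; ring

lemma orient_swap (a b c : Pt) : orient a c b = -orient a b c := by
  simp only [orient]; ring

lemma orient_swap' (a b c : Pt) : orient b a c = -orient a b c := by
  simp only [orient]; ring

@[simp] lemma orient_self_left (a b : Pt) : orient a a b = 0 := by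
  simp only [orient]; ring

@[simp] lemma orient_self_outer (a b : Pt) : orient a b a = 0 := by
  simp only [orient]; ring

@[simp] lemma orient_self_right (a b : Pt) : orient a b b = 0 := by
  simp only [orient]; ring

lemma orient_add (a b c x : Pt) :
    orient a b x + orient b c x + orient c a x = orient a b c := by
  simp only [orient]; ring

lemma orient_bary (a b c x u v : Pt) :
    orient b c x * orient u v a + orient c a x * orient u v b + orient a b x * orient u v c
      = orient a b c * orient u v x := by
  simp only [orient]; ring

lemma orient_lin (u v : Pt) (t : ℝ) (a b : Pt) :
    orient u v (lin t a b) = (1 - t) * orient u v a + t * orient u v b := by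
  simp only [orient, lin]; ring

lemma lin_swap (t : ℝ) (a b : Pt) : lin (1 - t) b a = lin t a b := by
  ext <;> simp only [lin] <;> ring

/-- The segments `a b` and `c d` cross transversally. -/
def Crosses (a b c d : Pt) : Prop :=
  orient a b c * orient a b d < 0 ∧ orient c d a * orient c d b < 0

lemma Crosses.symm {a b c d : Pt} (h : Crosses a b c d) : Crosses c d a b := ⟨h.2, h.1⟩

lemma Crosses.swap_right {a b c d : Pt} (h : Crosses a b c d) : Crosses a b d c := by
  refine ⟨by linarith [h.1, mul_comm (orient a b c) (orient a b d)], ?_⟩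
  rw [orient_swap' c d a, orient_swap' c d b]; linarith [h.2]

lemma Crosses.exists_point {a b c d : Pt} (h : Crosses a b c d) :
    ∃ s t : ℝ, 0 < s ∧ s < 1 ∧ 0 < t ∧ t < 1 ∧ lin s a b = lin t c d := by
  have key : ∀ x y : ℝ, x * y < 0 → 0 < x / (x - y) ∧ x / (x - y) < 1 := by
    intro x y hxy
    rcases mul_neg_iff.1 hxy with ⟨h1, h2⟩ | ⟨h1, h2⟩
    · exact ⟨div_pos h1 (by linarith), (div_lt_one (by linarith)).2 (by linarith)⟩
    · exact ⟨div_pos_of_neg_of_neg h1 (by linarith),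
        (div_lt_one_of_neg (by linarith)).2 (by linarith)⟩
  obtain ⟨t0, t1⟩ := key _ _ h.1
  obtain ⟨s0, s1⟩ := key _ _ h.2
  refine ⟨_, _, s0, s1, t0, t1, ?_⟩
  have e1 : orient a b c - orient a b d ≠ 0 := by
    intro e; have := h.1; rw [sub_eq_zero.1 e] at this; nlinarith [mul_self_nonneg (orient a b d)]
  have e2 : orient c d a - orient c d b ≠ 0 := by
    intro e; have := h.2; rw [sub_eq_zero.1 e] at this; nlinarith [mul_self_nonneg (orient c d b)]
  have e3 : orient c d a - orient c d b = -(orient a b c - orient a b d) := by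
    simp only [orient]; ring
  rw [e3] at e2 ⊢
  ext <;> simp only [lin] <;> field_simp <;> simp only [orient] <;> ring

lemma crosses_of_lin {a b c d : Pt} {s t : ℝ} (hs0 : 0 < s) (hs1 : s < 1) (ht0 : 0 < t)
    (ht1 : t < 1) (h : lin s a b = lin t c d) (h1 : orient a b c ≠ 0) (h2 : orient c d a ≠ 0) :
    Crosses a b c d := by
  have key : ∀ r x y : ℝ, 0 < r → r < 1 → (1 - r) * x + r * y = 0 → x ≠ 0 → x * y < 0 := by
    intro r x y hr0 hr1 e hx
    have : r * (x * y) = -((1 - r) * (x * x)) := by linear_combination x * e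
    have h3 : 0 < x * x := mul_self_pos.2 hx
    have h4 : 0 < (1 - r) * (x * x) := mul_pos (by linarith) h3
    by_contra h5
    nlinarith [mul_nonneg hr0.le (not_lt.1 h5)]
  constructor
  · refine key t _ _ ht0 ht1 ?_ h1
    rw [← orient_lin, ← h, orient_lin]; simp
  · refine key s _ _ hs0 hs1 ?_ h2
    rw [← orient_lin, h, orient_lin]; simp

/-- `x` lies strictly inside the counterclockwise triangle `a b c`. -/
def Inside (a b c x : Pt) : Prop := 0 < orient a b x ∧ 0 < orient b c x ∧ 0 < orient c a x

lemma Inside.rot {a b c x : Pt} (h : Inside a b c x) : Inside b c a x := ⟨h.2.1, h.2.2, h.1⟩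

lemma Inside.orient_pos {a b c x : Pt} (h : Inside a b c x) : 0 < orient a b c := by
  rw [← orient_add a b c x]; linarith [h.1, h.2.1, h.2.2]

lemma wedge_exit_signs {Ax Bx Cx Au Bu Cu Av Bv dp da db t : ℝ} (ht0 : 0 < t) (ht1 : t < 1)
    (hB : Bx = (1 - t) * Bu + t * Bv) (hA : Ax = (1 - t) * Au + t * Av)
    (hx : Ax * da + Bx * db + Cx * dp = 0) (hu : Au * da + Bu * db + Cu * dp = 0)
    (hAx : 0 < Ax) (hBx : 0 < Bx) (hCx : 0 ≤ Cx) (hCu : 0 < Cu) (hp : dp ≠ 0) (hBu : Bu < 0) :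
    (Bu * Bv < 0 ∧ dp * da < 0) ∨ (Au * Av < 0 ∧ dp * db < 0) := by
  have pos : ∀ X U V : ℝ, X = (1 - t) * U + t * V → 0 < X → U < 0 → 0 < V := by
    intro X U V h h1 h2
    have h3 : (1 - t) * U < 0 := mul_neg_of_pos_of_neg (by linarith) h2
    exact pos_of_mul_pos_right (by linarith : 0 < t * V) ht0.le
  by_cases hM : dp * da < 0
  · exact Or.inl ⟨mul_neg_of_neg_of_pos hBu (pos _ _ _ hB hBx hBu), hM⟩
  right
  push Not at hM
  have hP : 0 < dp * dp := mul_self_pos.2 hp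
  have ex : Cx * (dp * dp) + Ax * (dp * da) + Bx * (dp * db) = 0 := by
    linear_combination dp * hx
  have eu : Cu * (dp * dp) + Au * (dp * da) + Bu * (dp * db) = 0 := by
    linear_combination dp * hu
  generalize dp * dp = P at *
  generalize dp * da = M at *
  generalize dp * db = N at *
  have c1 := mul_nonneg hCx hP.le
  have c2 := mul_nonneg hAx.le hM
  have c3 := mul_pos hCu hP
  have hN : N < 0 := by
    by_contra hN
    push Not at hN
    have c4 := mul_nonneg hBx.le hN
    have z1 : N = 0 := by
      rcases mul_eq_zero.1 (by linarith : Bx * N = 0) with h | h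
      · linarith
      · exact h
    have z2 : M = 0 := by
      rcases mul_eq_zero.1 (by linarith : Ax * M = 0) with h | h
      · linarith
      · exact h
    subst z1 z2
    linarith
  have c5 : 0 < Bu * N := mul_pos_of_neg_of_neg hBu hN
  have hAu : Au < 0 := by
    by_contra h
    have := mul_nonneg (not_lt.1 h) hM
    linarith
  exact ⟨mul_neg_of_neg_of_pos hAu (pos _ _ _ hA hAx hAu), hN⟩

/-- A segment leaving the triangle `p a b` on the `p`-side of the line `a b` crosses `p a`
or `p b`. -/
lemma wedge_exit {p a b u v : Pt} {t : ℝ} (ht0 : 0 < t) (ht1 : t < 1)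
    (h1 : 0 < orient p a (lin t u v)) (h2 : 0 < orient b p (lin t u v))
    (h3 : 0 ≤ orient a b (lin t u v)) (hu : 0 < orient a b u)
    (hw : orient p a u < 0 ∨ orient b p u < 0) (hp : orient u v p ≠ 0) :
    Crosses p a u v ∨ Crosses p b u v := by
  have ex := orient_bary p a b (lin t u v) u v
  have eu := orient_bary p a b u u v
  have z : orient u v (lin t u v) = 0 := by rw [orient_lin]; simp
  rw [z, mul_zero] at ex
  rw [orient_self_outer, mul_zero] at eu
  have s1 : ∀ x, orient p b x = -orient b p x := fun x => orient_swap' b p x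
  rcases hw with hw | hw
  · rcases wedge_exit_signs (da := orient u v a) (db := orient u v b) ht0 ht1
      (orient_lin p a t u v) (orient_lin b p t u v)
      (by linarith) (by linarith) h2 h1 h3 hu hp hw with h | h
    · exact Or.inl h
    · exact Or.inr ⟨by rw [s1, s1]; linarith [h.1], h.2⟩
  · rcases wedge_exit_signs (da := orient u v b) (db := orient u v a) ht0 ht1
      (orient_lin b p t u v) (orient_lin p a t u v)
      (by linarith) (by linarith) h1 h2 h3 hu hp hw with h | h
    · exact Or.inr ⟨by rw [s1, s1]; linarith [h.1], h.2⟩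
    · exact Or.inl h

/-- No three distinct points of `P` are collinear, in terms of `orient`. -/
def Generic (P : Finset Pt) : Prop :=
  ∀ p ∈ P, ∀ q ∈ P, ∀ r ∈ P, p ≠ q → p ≠ r → q ≠ r → orient p q r ≠ 0

lemma Generic.mono {P Q : Finset Pt} (h : Generic P) (hQ : Q ⊆ P) : Generic Q :=
  fun p hp q hq r hr => h p (hQ hp) q (hQ hq) r (hQ hr)

/-- `G` is a plane graph on `P`, in terms of `Crosses`. -/
structure Plane (P : Finset Pt) (G : Finset (Sym2 Pt)) : Prop where
  ne : ∀ {a b : Pt}, s(a, b) ∈ G → a ≠ b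
  left_mem : ∀ {a b : Pt}, s(a, b) ∈ G → a ∈ P
  not_crosses : ∀ {a b c d : Pt}, s(a, b) ∈ G → s(c, d) ∈ G → ¬ Crosses a b c d

lemma Plane.right_mem {P : Finset Pt} {G : Finset (Sym2 Pt)} (h : Plane P G) {a b : Pt}
    (hab : s(a, b) ∈ G) : b ∈ P := h.left_mem (Sym2.eq_swap ▸ hab)

/-- `T` is an edge-maximal plane graph on `P`. -/
structure Triang (P : Finset Pt) (T : Finset (Sym2 Pt)) : Prop extends Plane P T where
  maximal : ∀ {a b : Pt}, a ∈ P → b ∈ P → a ≠ b →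
    (∀ c d, s(c, d) ∈ T → ¬ Crosses a b c d) → s(a, b) ∈ T

variable {P : Finset Pt} {T G : Finset (Sym2 Pt)}

lemma Triang.exists_crossing (hT : Triang P T) {a b : Pt} (ha : a ∈ P) (hb : b ∈ P)
    (hab : a ≠ b) (h : s(a, b) ∉ T) : ∃ c d, s(c, d) ∈ T ∧ Crosses a b c d := by
  by_contra hc
  push Not at hc
  exact h (hT.maximal ha hb hab hc)

lemma Plane.no_exit (gp : Generic P) (hG : Plane P G) {p a b u v : Pt} {t : ℝ}
    (hpa : s(p, a) ∈ G) (hpb : s(p, b) ∈ G) (huv : s(u, v) ∈ G) (ht0 : 0 < t) (ht1 : t < 1)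
    (h1 : 0 < orient p a (lin t u v)) (h2 : 0 < orient b p (lin t u v))
    (h3 : 0 ≤ orient a b (lin t u v)) (hu : 0 < orient a b u) (hin : ¬ Inside p a b u)
    (hne : orient u v p ≠ 0) : False := by
  have hp := hG.left_mem hpa
  have ha := hG.right_mem hpa
  have hb := hG.right_mem hpb
  have huP := hG.left_mem huv
  have hup : u ≠ p := by rintro rfl; simp at hne
  have hua : u ≠ a := by rintro rfl; simp at hu
  have hub : u ≠ b := by rintro rfl; simp at hu
  have n1 := gp p hp a ha u huP (hG.ne hpa) hup.symm hua.symm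
  have n2 := gp b hb p hp u huP (hG.ne hpb).symm hub.symm hup.symm
  have hw : orient p a u < 0 ∨ orient b p u < 0 := by
    by_contra hw
    push Not at hw
    exact hin ⟨lt_of_le_of_ne hw.1 n1.symm, hu, lt_of_le_of_ne hw.2 n2.symm⟩
  rcases wedge_exit ht0 ht1 h1 h2 h3 hu hw hne with h | h
  · exact hG.not_crosses hpa huv h
  · exact hG.not_crosses hpb huv h

/-- Two angularly consecutive neighbours of `p` bound an empty triangle. -/
lemma Triang.consecutive (gp : Generic P) (hT : Triang P T) {p a b : Pt} (hpa : s(p, a) ∈ T)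
    (hpb : s(p, b) ∈ T) (hD : 0 < orient p a b)
    (hc : ∀ c, s(p, c) ∈ T → ¬ (0 < orient p a c ∧ 0 < orient b p c)) :
    s(a, b) ∈ T ∧ ∀ c ∈ P, ¬ Inside p a b c := by
  have hp := hT.left_mem hpa
  have ha := hT.right_mem hpa
  have hb := hT.right_mem hpb
  have empty : ∀ c ∈ P, ¬ Inside p a b c := by
    by_contra hex
    push Not at hex
    obtain ⟨c1, hc1, hin1⟩ := hex
    obtain ⟨c, hcA, hmax⟩ := Finset.exists_max_image (P.filter fun c => Inside p a b c)
      (fun c => orient a b c) ⟨c1, by simp [hc1, hin1]⟩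
    simp only [Finset.mem_filter] at hcA hmax
    obtain ⟨hcP, hin⟩ := hcA
    have hpc : p ≠ c := by rintro rfl; have := hin.1; simp at this
    obtain ⟨u, v, huv, hX⟩ := hT.exists_crossing hp hcP hpc
      (fun h => hc c h ⟨hin.1, hin.2.2⟩)
    obtain ⟨s, t, hs0, hs1, ht0, ht1, he⟩ := hX.exists_point
    have lt : orient a b c < orient p a b := by
      have := orient_add p a b c; linarith [hin.1, hin.2.2]
    have f1 : orient a b c < orient a b (lin s p c) := by
      rw [orient_lin, orient_rot p a b]; nlinarith
    have f2 : 0 < orient p a (lin s p c) := by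
      rw [orient_lin]; simp; exact mul_pos hs0 hin.1
    have f3 : 0 < orient b p (lin s p c) := by
      rw [orient_lin]; simp; exact mul_pos hs0 hin.2.2
    rw [he] at f1 f2 f3
    have f4 : 0 ≤ orient a b (lin t u v) := by linarith [hin.2.1]
    have hne : orient u v p ≠ 0 := by
      intro h; have := hX.2; rw [h, zero_mul] at this; exact lt_irrefl _ this
    by_cases hu : orient a b c < orient a b u
    · exact hT.no_exit gp hpa hpb huv ht0 ht1 f2 f3 f4 (by linarith [hin.2.1])
        (fun h => absurd (hmax u ⟨hT.left_mem huv, h⟩) (not_le.2 hu)) hne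
    · have hv : orient a b c < orient a b v := by
        by_contra hv
        rw [orient_lin] at f1
        nlinarith
      rw [← lin_swap] at f2 f3 f4
      exact hT.no_exit gp hpa hpb (Sym2.eq_swap ▸ huv) (by linarith) (by linarith) f2 f3 f4
        (by linarith [hin.2.1])
        (fun h => absurd (hmax v ⟨hT.right_mem huv, h⟩) (not_le.2 hv))
        (by rw [orient_swap']; simpa using hne)
  refine ⟨?_, empty⟩
  by_contra hab
  have hne : a ≠ b := by rintro rfl; simp at hD
  obtain ⟨u, v, huv, hX⟩ := hT.exists_crossing ha hb hne hab
  obtain ⟨s, t, hs0, hs1, ht0, ht1, he⟩ := hX.exists_point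
  have f2 : 0 < orient p a (lin s a b) := by
    rw [orient_lin]; simp; exact mul_pos hs0 hD
  have f3 : 0 < orient b p (lin s a b) := by
    rw [orient_lin]; simp only [orient_self_outer]
    rw [orient_rot a b p, orient_rot p a b]; nlinarith
  have f4 : 0 ≤ orient a b (lin s a b) := by rw [orient_lin]; simp
  rw [he] at f2 f3 f4
  have hup : ∀ {u v : Pt} {t : ℝ}, s(u, v) ∈ T → 0 < t → 0 < orient p a (lin t u v) →
      0 < orient b p (lin t u v) → orient a b v < 0 → orient u v p ≠ 0 := by
    intro u v t huv ht f2 f3 hv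
    have huP := hT.left_mem huv
    have hvP := hT.right_mem huv
    have h1 : u ≠ p := by
      rintro rfl
      rw [orient_lin] at f2 f3
      simp only [orient_self_outer, orient_self_right, mul_zero, zero_add] at f2 f3
      exact hc v huv ⟨pos_of_mul_pos_right f2 ht.le, pos_of_mul_pos_right f3 ht.le⟩
    have h2 : v ≠ p := by
      rintro rfl
      rw [orient_rot] at hv
      linarith
    exact gp u huP v hvP p hp (hT.ne huv) h1 h2
  rcases mul_neg_iff.1 hX.1 with ⟨hu, hv⟩ | ⟨hu, hv⟩
  · exact hT.no_exit gp hpa hpb huv ht0 ht1 f2 f3 f4 hu (empty u (hT.left_mem huv)) (hup huv ht0 f2 f3 hv)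
  · rw [← lin_swap] at f2 f3 f4
    exact hT.no_exit gp hpa hpb (Sym2.eq_swap ▸ huv) (by linarith) (by linarith) f2 f3 f4 hv
      (empty v (hT.right_mem huv)) (hup (Sym2.eq_swap ▸ huv) (by linarith) f2 f3 hu)

/-- No edge enters an empty triangle of a plane graph. -/
lemma Plane.not_inside (gp : Generic P) (hG : Plane P G) {a b c u v : Pt} {t : ℝ}
    (hab : s(a, b) ∈ G) (hbc : s(b, c) ∈ G) (hca : s(c, a) ∈ G)
    (empty : ∀ x ∈ P, ¬ Inside a b c x) (huv : s(u, v) ∈ G) (ht0 : 0 < t) (ht1 : t < 1) :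
    ¬ Inside a b c (lin t u v) := by
  intro hin
  have ha := hG.left_mem hab
  have hb := hG.left_mem hbc
  have hc := hG.left_mem hca
  have main : ∀ {u v : Pt} {t : ℝ}, s(u, v) ∈ G → 0 < t → t < 1 → Inside a b c (lin t u v) →
      u ≠ a → u ≠ b → u ≠ c → False := by
    intro u v t huv ht0 ht1 hin hua hub huc
    have huP := hG.left_mem huv
    have hvP := hG.right_mem huv
    have huv' := hG.ne huv
    have hD := orient_add a b c u
    have hDpos := hin.orient_pos
    have i1 := hin.1
    have i2 := hin.2.1
    have i3 := hin.2.2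
    by_cases ca : 0 < orient b c u ∧ v ≠ a
    · exact hG.no_exit gp hab (Sym2.eq_swap ▸ hca) huv ht0 ht1 i1 i3 i2.le ca.1 (empty u huP)
        (gp u huP v hvP a ha huv' hua ca.2)
    by_cases cb : 0 < orient c a u ∧ v ≠ b
    · exact hG.no_exit gp hbc (Sym2.eq_swap ▸ hab) huv ht0 ht1 i2 i1 i3.le cb.1
        (fun h => empty u huP h.rot.rot) (gp u huP v hvP b hb huv' hub cb.2)
    by_cases cc : 0 < orient a b u ∧ v ≠ c
    · exact hG.no_exit gp hca (Sym2.eq_swap ▸ hbc) huv ht0 ht1 i3 i2 i1.le cc.1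
        (fun h => empty u huP h.rot) (gp u huP v hvP c hc huv' huc cc.2)
    have ab := hG.ne hab
    have bc := hG.ne hbc
    have ac := hG.ne hca
    have aux : ∀ x y, 0 < (1 - t) * x + t * 0 → y = x → 0 < y := by
      rintro x y h rfl
      exact pos_of_mul_pos_right (by linarith : 0 < (1 - t) * y) (by linarith)
    rw [orient_lin] at i1 i2 i3
    by_cases va : v = a
    · subst va
      simp only [orient_self_outer, orient_self_right] at i1 i3
      exact cb ⟨aux _ _ i3 rfl, ab⟩
    by_cases vb : v = b
    · subst vb
      simp only [orient_self_outer, orient_self_right] at i1 i2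
      exact cc ⟨aux _ _ i1 rfl, bc⟩
    by_cases vc : v = c
    · subst vc
      simp only [orient_self_outer, orient_self_right] at i2 i3
      exact ca ⟨aux _ _ i2 rfl, ac⟩
    simp only [ne_eq, va, vb, vc, not_false_eq_true, and_true] at ca cb cc
    linarith
  by_cases h1 : u ≠ a ∧ u ≠ b ∧ u ≠ c
  · exact main huv ht0 ht1 hin h1.1 h1.2.1 h1.2.2
  by_cases h2 : v ≠ a ∧ v ≠ b ∧ v ≠ c
  · rw [← lin_swap] at hin
    exact main (Sym2.eq_swap ▸ huv) (by linarith) (by linarith) hin h2.1 h2.2.1 h2.2.2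
  have i1 := hin.1
  have i2 := hin.2.1
  have i3 := hin.2.2
  rw [orient_lin] at i1 i2 i3
  have hu : u = a ∨ u = b ∨ u = c := by tauto
  have hv : v = a ∨ v = b ∨ v = c := by tauto
  rcases hu with rfl | rfl | rfl <;> rcases hv with rfl | rfl | rfl <;> simp at i1 i2 i3

/-- The signed distance, up to scaling, of `c` from the line through `p` normal to `m`. -/
def side (m p c : Pt) : ℝ := m.1 * (c.1 - p.1) + m.2 * (c.2 - p.2)

@[simp] lemma side_self (m p : Pt) : side m p p = 0 := by simp [side]

lemma side_lin (m p : Pt) (t : ℝ) (a b : Pt) :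
    side m p (lin t a b) = (1 - t) * side m p a + t * side m p b := by
  simp only [side, lin]; ring

lemma side_mul_orient (m p a b c : Pt) :
    side m p a * orient p b c = side m p b * orient p a c - side m p c * orient p a b := by
  simp only [side, orient]; ring

/-- In an open half-plane bounded by a line through `p` there is a clockwise-most point. -/
lemma exists_clockwise_most {m p : Pt} {A : Finset Pt} (hA : A.Nonempty)
    (hpos : ∀ c ∈ A, 0 < side m p c) : ∃ b ∈ A, ∀ c ∈ A, 0 ≤ orient p b c := by
  obtain ⟨b, hb, hmin⟩ := Finset.exists_min_image A
    (fun c => side (-m.2, m.1) p c / side m p c) hA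
  refine ⟨b, hb, fun c hc => ?_⟩
  have h := hmin c hc
  rw [div_le_div_iff₀ (hpos b hb) (hpos c hc)] at h
  have hm : 0 < m.1 ^ 2 + m.2 ^ 2 := by
    have h1 := hpos b hb
    by_contra h2
    have h3 : m.1 = 0 := by nlinarith [sq_nonneg m.1, sq_nonneg m.2]
    have h4 : m.2 = 0 := by nlinarith [sq_nonneg m.1, sq_nonneg m.2]
    simp [side, h3, h4] at h1
  have e : (m.1 ^ 2 + m.2 ^ 2) * orient p b c =
      side (-m.2, m.1) p c * side m p b - side (-m.2, m.1) p b * side m p c := by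
    simp only [side, orient]; ring
  exact nonneg_of_mul_nonneg_right (by rw [e]; linarith : 0 ≤ _ * orient p b c) hm

lemma exists_zero_of_neg_of_pos {x y : ℝ} (hx : x < 0) (hy : 0 < y) :
    ∃ r : ℝ, 0 < r ∧ r < 1 ∧ (1 - r) * x + r * y = 0 := by
  refine ⟨x / (x - y), div_pos_of_neg_of_neg hx (by linarith),
    (div_lt_one_of_neg (by linarith)).2 (by linarith), ?_⟩
  have : x - y ≠ 0 := by linarith
  field_simp
  ring

lemma orient_lin_mul (m n : Pt) (r t : ℝ) (u v : Pt) :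
    orient m n (lin (r * t) u v) = (1 - r) * orient m n u + r * orient m n (lin t u v) := by
  simp only [orient_lin]; ring

lemma exists_lin_of_orient_eq_zero {u v z : Pt} (huv : u ≠ v) (h : orient u v z = 0) :
    ∃ q : ℝ, z = lin q u v := by
  simp only [orient] at h
  by_cases h1 : v.1 = u.1
  · have h2 : v.2 - u.2 ≠ 0 := fun h2 => huv (Prod.ext h1.symm (by linarith))
    have h3 : z.1 = u.1 := by
      have : (v.2 - u.2) * (z.1 - u.1) = 0 := by rw [h1] at h; linarith
      have := (mul_eq_zero.1 this).resolve_left h2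
      linarith
    refine ⟨(z.2 - u.2) / (v.2 - u.2), ?_⟩
    ext
    · simp only [lin, h1, h3]; ring
    · simp only [lin]; field_simp; ring
  · have h2 : v.1 - u.1 ≠ 0 := sub_ne_zero.2 h1
    refine ⟨(z.1 - u.1) / (v.1 - u.1), ?_⟩
    ext
    · simp only [lin]; field_simp; ring
    · simp only [lin]; field_simp; linarith

set_option maxHeartbeats 1000000 in
/-- A vertex of a triangulation has a neighbour in every open half-plane through it that
contains a point of `P`. -/
lemma Triang.exists_adj (gp : Generic P) (hT : Triang P T) {p m : Pt} (hp : p ∈ P)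
    (hm : ∃ c ∈ P, 0 < side m p c) : ∃ c, s(p, c) ∈ T ∧ 0 < side m p c := by
  obtain ⟨c1, hc1, hc1m⟩ := hm
  obtain ⟨c, hcH, hcmin⟩ := exists_clockwise_most (m := m) (p := p)
    (A := P.filter fun c => 0 < side m p c) ⟨c1, by simp [hc1, hc1m]⟩ (by simp)
  simp only [Finset.mem_filter] at hcH hcmin
  obtain ⟨hcP, hcpos⟩ := hcH
  by_cases hadj : s(p, c) ∈ T
  · exact ⟨c, hadj, hcpos⟩
  have hpc : p ≠ c := by rintro rfl; simp at hcpos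
  have hE : ((P ×ˢ P).filter fun e : Pt × Pt =>
      s(e.1, e.2) ∈ T ∧ Crosses p c e.1 e.2 ∧ orient p c e.1 < 0).Nonempty := by
    obtain ⟨u, v, huv, hX⟩ := hT.exists_crossing hp hcP hpc hadj
    rcases mul_neg_iff.1 hX.1 with ⟨_, h⟩ | ⟨h, _⟩
    · exact ⟨(v, u), by
        simp only [Finset.mem_filter, Finset.mem_product]
        exact ⟨⟨hT.right_mem huv, hT.left_mem huv⟩, Sym2.eq_swap ▸ huv, hX.swap_right, h⟩⟩
    · exact ⟨(u, v), by
        simp only [Finset.mem_filter, Finset.mem_product]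
        exact ⟨⟨hT.left_mem huv, hT.right_mem huv⟩, huv, hX, h⟩⟩
  obtain ⟨⟨u, v⟩, he, hmin⟩ := Finset.exists_min_image _
    (fun e : Pt × Pt => orient e.1 e.2 p / (orient e.1 e.2 p - orient e.1 e.2 c)) hE
  simp only [Finset.mem_filter, Finset.mem_product] at he hmin
  obtain ⟨⟨huP, hvP⟩, huv, hX, hcu⟩ := he
  have hcv : 0 < orient p c v := by nlinarith [hX.1]
  have signs : ∀ {u v : Pt}, Crosses p c u v → orient p c u < 0 →
      0 < orient u v p ∧ orient u v c < 0 := by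
    intro u v hX h
    have e : orient u v p - orient u v c = orient p c v - orient p c u := by
      simp only [orient]; ring
    have h1 : 0 < orient p c v := by nlinarith [hX.1]
    rcases mul_neg_iff.1 hX.2 with h2 | h2
    · exact h2
    · linarith
  obtain ⟨hdp, hdc⟩ := signs hX hcu
  obtain ⟨s, t, hs0, hs1, ht0, ht1, hx⟩ := hX.exists_point
  have hum : side m p u ≤ 0 := by
    by_contra h
    linarith [hcmin u ⟨huP, not_le.1 h⟩]
  have hvm : 0 < side m p v := by
    have h1 : 0 < side m p (lin s p c) := by
      rw [side_lin, side_self]; nlinarith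
    rw [hx, side_lin] at h1
    by_contra h
    nlinarith
  obtain ⟨w, hwA, hwmin⟩ := exists_clockwise_most (m := m) (p := p)
    (A := P.filter fun w => 0 < side m p w ∧ 0 ≤ orient u v w ∧ 0 ≤ orient p w v)
    ⟨v, by simp [hvP, hvm]⟩ (by simp +contextual)
  simp only [Finset.mem_filter] at hwA hwmin
  obtain ⟨hwP, hwm, hdw, hwv⟩ := hwA
  refine ⟨w, ?_, hwm⟩
  by_contra hnadj
  have hpw : p ≠ w := by rintro rfl; simp at hwm
  have hcw : 0 < orient p c w := by
    refine lt_of_le_of_ne (hcmin w ⟨hwP, hwm⟩) (gp p hp c hcP w hwP hpc hpw ?_).symm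
    rintro rfl; linarith
  have hwc : orient p w c < 0 := by rw [orient_swap]; linarith
  have hwu : orient p w u < 0 := by
    have h1 : orient p w (lin s p c) < 0 := by
      rw [orient_lin, orient_self_outer]; nlinarith
    rw [hx, orient_lin] at h1
    by_contra h
    nlinarith
  have main : ∀ u' v', s(u', v') ∈ T → Crosses p w u' v' → orient p w u' < 0 → False := by
    intro u' v' huv' hX' hwu'
    have hu'P := hT.left_mem huv'
    have hv'P := hT.right_mem huv'
    obtain ⟨s', t', hs0', hs1', ht0', ht1', hy⟩ := hX'.exists_point
    have hwy : orient p w (lin t' u' v') = 0 := by rw [← hy, orient_lin]; simp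
    have hcy : 0 < orient p c (lin t' u' v') := by
      rw [← hy, orient_lin, orient_self_outer]; nlinarith
    have hdy : 0 < orient u v (lin t' u' v') := by
      rw [← hy, orient_lin]; nlinarith
    have blocked : ∀ r, 0 < r → r < 1 → orient u v (lin (r * t') u' v') = 0 →
        orient p c (lin (r * t') u' v') < 0 := by
      intro r hr0 hr1 hz
      by_contra hcz
      push Not at hcz
      have hwz : orient p w (lin (r * t') u' v') < 0 := by
        rw [orient_lin_mul, hwy]; nlinarith
      have hrt0 : 0 < r * t' := mul_pos hr0 ht0'
      have hrt1 : r * t' < 1 := by nlinarith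
      obtain ⟨q, hq⟩ := exists_lin_of_orient_eq_zero (hT.ne huv) hz
      have hq0 : 0 < q := by
        rw [hq, orient_lin] at hcz
        by_contra h
        nlinarith
      have hq1 : q < 1 := by
        rw [hq, orient_lin] at hwz
        by_contra h
        nlinarith
      have hdu' : orient u v u' ≠ 0 := by
        intro h
        rw [orient_lin_mul, h] at hz
        nlinarith
      have hdv' : orient u v v' ≠ 0 := by
        intro h
        rw [orient_lin, h, mul_zero, add_zero] at hz
        exact (mul_ne_zero (by linarith) hdu') hz
      refine hT.not_crosses huv huv' (crosses_of_lin hq0 hq1 hrt0 hrt1 hq.symm hdu' ?_)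
      refine gp u' hu'P v' hv'P u huP (hT.ne huv') ?_ ?_
      · rintro rfl; simp at hdu'
      · rintro rfl; simp at hdv'
    have early : orient p c u' < 0 → (∀ r, 0 < r → r < 1 →
        orient p c (lin (r * t') u' v') = 0 → 0 < orient u v (lin (r * t') u' v')) → False := by
      intro hcu' hd
      obtain ⟨r, hr0, hr1, hr⟩ := exists_zero_of_neg_of_pos hcu' hcy
      rw [← orient_lin_mul] at hr
      have hdz := hd r hr0 hr1 hr
      have hwz : orient p w (lin (r * t') u' v') < 0 := by
        rw [orient_lin_mul, hwy]; nlinarith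
      have hrt0 : 0 < r * t' := mul_pos hr0 ht0'
      have hrt1 : r * t' < 1 := by nlinarith
      obtain ⟨q, hq⟩ := exists_lin_of_orient_eq_zero hpc hr
      have hq0 : 0 < q := by
        rw [hq, orient_lin, orient_self_outer] at hwz
        by_contra h
        nlinarith
      have hqf : q < orient u v p / (orient u v p - orient u v c) := by
        rw [hq, orient_lin] at hdz
        rw [lt_div_iff₀ (by linarith)]
        linarith
      have hf1 : orient u v p / (orient u v p - orient u v c) < 1 :=
        (div_lt_one (by linarith)).2 (by linarith)
      have hne : orient u' v' p ≠ 0 := by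
        intro h
        have := hX'.2
        rw [h, zero_mul] at this
        exact lt_irrefl _ this
      have hXc := crosses_of_lin hq0 (by linarith) hrt0 hrt1 hq.symm hcu'.ne hne
      obtain ⟨k1, k2⟩ := signs hXc hcu'
      have hle := hmin (u', v') ⟨⟨hu'P, hv'P⟩, huv', hXc, hcu'⟩
      have : orient u' v' (lin q p c) = 0 := by rw [← hq, orient_lin]; simp
      rw [orient_lin] at this
      have hq' : orient u' v' p / (orient u' v' p - orient u' v' c) = q := by
        rw [div_eq_iff (by linarith)]; linarith
      simp only [hq'] at hle
      linarith
    by_cases hdu' : orient u v u' < 0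
    · obtain ⟨r, hr0, hr1, hr⟩ := exists_zero_of_neg_of_pos hdu' hdy
      have hb := blocked r hr0 hr1 (by rw [orient_lin_mul, hr])
      rw [orient_lin_mul] at hb
      refine early (by by_contra h; nlinarith) fun r' hr0' hr1' hz => ?_
      rw [orient_lin_mul] at hz ⊢
      have hlt : r < r' := by
        by_contra h
        push Not at h
        nlinarith
      nlinarith
    · push Not at hdu'
      refine early ?_ fun r' hr0' hr1' hz => ?_
      · by_cases hu'm : 0 < side m p u'
        · exfalso
          have h1 := side_mul_orient m p w u' v
          have h2 : 0 < orient p u' v := by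
            refine pos_of_mul_pos_right (b := orient p u' v) (a := side m p w) ?_ hwm.le
            rw [h1]
            nlinarith [mul_nonneg hu'm.le hwv, mul_neg_of_pos_of_neg hvm hwu']
          linarith [hwmin u' ⟨hu'P, hu'm, hdu', h2.le⟩]
        · have h1 := side_mul_orient m p w c u'
          by_contra h
          rw [orient_swap] at hwc
          nlinarith [mul_neg_of_pos_of_neg hcpos hwu', mul_nonneg hwm.le (not_lt.1 h),
            mul_nonneg (neg_nonneg.2 (not_lt.1 hu'm)) hcw.le, orient_swap p c w]
      · rw [orient_lin_mul]
        nlinarith [mul_nonneg (by linarith : (0:ℝ) ≤ 1 - r') hdu', mul_pos hr0' hdy]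
  obtain ⟨u', v', huv', hX'⟩ := hT.exists_crossing hp hwP hpw hnadj
  rcases mul_neg_iff.1 hX'.1 with ⟨_, h⟩ | ⟨h, _⟩
  · exact main v' u' (Sym2.eq_swap ▸ huv') hX'.swap_right h
  · exact main u' v' huv' hX' h

lemma crosses_or_eq (gp : Generic P) {a b c d : Pt} {s t : ℝ} (ha : a ∈ P) (hb : b ∈ P)
    (hc : c ∈ P) (hd : d ∈ P) (hab : a ≠ b) (hcd : c ≠ d) (hs0 : 0 < s) (hs1 : s < 1)
    (ht0 : 0 < t) (ht1 : t < 1) (h : lin s a b = lin t c d) :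
    Crosses a b c d ∨ s(a, b) = s(c, d) := by
  have key : ∀ {a b c d : Pt} {s t : ℝ}, a ∈ P → b ∈ P → c ∈ P → d ∈ P → a ≠ b → c ≠ d →
      0 < t → lin s a b = lin t c d → orient a b c = 0 → s(a, b) = s(c, d) := by
    intro a b c d s t ha hb hc hd hab hcd ht0 h h0
    have h1 : orient a b d = 0 := by
      have : orient a b (lin s a b) = 0 := by rw [orient_lin]; simp
      rw [h, orient_lin, h0, mul_zero, zero_add] at this
      exact (mul_eq_zero.1 this).resolve_left ht0.ne'
    have mem : ∀ x ∈ P, orient a b x = 0 → x = a ∨ x = b := by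
      intro x hx hx0
      by_contra hne
      push Not at hne
      exact gp a ha b hb x hx hab hne.1.symm hne.2.symm hx0
    rcases mem c hc h0 with rfl | rfl <;> rcases mem d hd h1 with rfl | rfl
    · exact absurd rfl hcd
    · rfl
    · exact Sym2.eq_swap
    · exact absurd rfl hcd
  by_cases h1 : orient a b c = 0
  · exact Or.inr (key ha hb hc hd hab hcd ht0 h h1)
  by_cases h2 : orient c d a = 0
  · exact Or.inr (key hc hd ha hb hcd hab hs0 h.symm h2).symm
  exact Or.inl (crosses_of_lin hs0 hs1 ht0 ht1 h h1 h2)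

lemma Crosses.congr_right {a b c d c' d' : Pt} (h : Crosses a b c d) (e : s(c, d) = s(c', d')) :
    Crosses a b c' d' := by
  rcases Sym2.eq_iff.1 e with ⟨rfl, rfl⟩ | ⟨rfl, rfl⟩
  · exact h
  · exact h.swap_right

lemma not_crosses_self (a b : Pt) : ¬ Crosses a b a b := fun h => by simpa using h.1

lemma Plane.mono (hG : Plane P G) {H : Finset (Sym2 Pt)} (h : H ⊆ G) : Plane P H :=
  ⟨fun e => hG.ne (h e), fun e => hG.left_mem (h e), fun e f => hG.not_crosses (h e) (h f)⟩

lemma Plane.insert_edge (hG : Plane P G) {a b : Pt} (ha : a ∈ P) (hb : b ∈ P) (hab : a ≠ b)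
    (h : ∀ c d, s(c, d) ∈ G → ¬ Crosses a b c d) : Plane P (insert s(a, b) G) := by
  refine ⟨?_, ?_, ?_⟩
  · intro x y hxy
    rcases Finset.mem_insert.1 hxy with e | e
    · rcases Sym2.eq_iff.1 e with ⟨rfl, rfl⟩ | ⟨rfl, rfl⟩
      · exact hab
      · exact hab.symm
    · exact hG.ne e
  · intro x y hxy
    rcases Finset.mem_insert.1 hxy with e | e
    · rcases Sym2.eq_iff.1 e with ⟨rfl, rfl⟩ | ⟨rfl, rfl⟩
      · exact ha
      · exact hb
    · exact hG.left_mem e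
  · intro x y z w hxy hzw hX
    rcases Finset.mem_insert.1 hxy with e | e <;> rcases Finset.mem_insert.1 hzw with f | f
    · exact not_crosses_self a b ((hX.congr_right f).symm.congr_right e)
    · exact h z w f (hX.symm.congr_right e).symm
    · exact h x y e (hX.congr_right f).symm
    · exact hG.not_crosses e f hX

/-- Every open half-plane through `p` contains a point of `P`. -/
def Surrounded (P : Finset Pt) (p : Pt) : Prop := ∀ m : Pt, m ≠ 0 → ∃ c ∈ P, 0 < side m p c

lemma Inside.surrounded {a b c p : Pt} (h : Inside a b c p) (ha : a ∈ P) (hb : b ∈ P)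
    (hc : c ∈ P) : Surrounded P p := by
  intro m hm
  by_contra hn
  push Not at hn
  have e : orient b c p * side m p a + orient c a p * side m p b + orient a b p * side m p c
      = 0 := by
    simp only [side, orient]; ring
  have n1 := mul_nonneg h.2.1.le (neg_nonneg.2 (hn a ha))
  have n2 := mul_nonneg h.2.2.le (neg_nonneg.2 (hn b hb))
  have n3 := mul_nonneg h.1.le (neg_nonneg.2 (hn c hc))
  have z1 := (mul_eq_zero.1 (by linarith : orient b c p * side m p a = 0)).resolve_left h.2.1.ne'
  have z2 := (mul_eq_zero.1 (by linarith : orient c a p * side m p b = 0)).resolve_left h.2.2.ne'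
  have e1 : m.1 * orient p a b = side m p a * (b.2 - p.2) - side m p b * (a.2 - p.2) := by
    simp only [side, orient]; ring
  have e2 : m.2 * orient p a b = side m p b * (a.1 - p.1) - side m p a * (b.1 - p.1) := by
    simp only [side, orient]; ring
  have hp : orient p a b ≠ 0 := by rw [← orient_rot p a b]; exact h.1.ne'
  rw [z1, z2, zero_mul, zero_mul, sub_zero] at e1 e2
  exact hm (Prod.ext ((mul_eq_zero.1 e1).resolve_right hp) ((mul_eq_zero.1 e2).resolve_right hp))

/-- The neighbours of `p` in `G`. -/
def nb (P : Finset Pt) (G : Finset (Sym2 Pt)) (p : Pt) : Finset Pt :=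
  P.filter fun c => s(p, c) ∈ G

lemma Plane.mem_nb (hG : Plane P G) {p c : Pt} : c ∈ nb P G p ↔ s(p, c) ∈ G := by
  simp only [nb, Finset.mem_filter, and_iff_right_iff_imp]
  exact fun h => hG.right_mem h

/-- The neighbours of an interior vertex of a triangulation surround it. -/
lemma Triang.exists_inside (gp : Generic P) (hT : Triang P T) {p : Pt} (hp : p ∈ P)
    (hs : Surrounded P p) :
    ∃ a b c, s(p, a) ∈ T ∧ s(p, b) ∈ T ∧ s(p, c) ∈ T ∧ Inside a b c p := by
  obtain ⟨a, ha, -⟩ := hT.exists_adj gp hp (hs (1, 0) (by simp))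
  have hneg : ∀ a x : Pt, side (a.2 - p.2, -(a.1 - p.1)) p x = -orient p a x := by
    intro a x; simp only [side, orient]; ring
  have hm : ∀ a : Pt, p ≠ a → ((a.2 - p.2, -(a.1 - p.1)) : Pt) ≠ 0 := by
    intro a hpa h
    have h1 := congrArg Prod.fst h
    have h2 := congrArg Prod.snd h
    simp only [Prod.fst_zero, Prod.snd_zero] at h1 h2
    exact hpa (Prod.ext (by linarith) (by linarith))
  obtain ⟨b1, hb1, hb1'⟩ := hT.exists_adj gp hp (hs _ (hm a (hT.ne ha)))
  obtain ⟨b, hb, hmin⟩ := exists_clockwise_most (m := (a.2 - p.2, -(a.1 - p.1))) (p := p)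
    (A := (nb P T p).filter fun x => 0 < side (a.2 - p.2, -(a.1 - p.1)) p x)
    ⟨b1, by rw [Finset.mem_filter]; exact ⟨hT.mem_nb.2 hb1, hb1'⟩⟩
    (fun c hc => (Finset.mem_filter.1 hc).2)
  simp only [Finset.mem_filter, hT.mem_nb, hneg] at hb hmin
  obtain ⟨c, hc, hc'⟩ := hT.exists_adj gp hp (hs _ (hm b (hT.ne hb.1)))
  rw [hneg] at hc'
  have hba := orient_swap p a b
  have hca : c ≠ a := by rintro rfl; linarith
  have hac := gp p hp a (hT.right_mem ha) c (hT.right_mem hc) (hT.ne ha) (hT.ne hc) hca.symm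
  have hac' : 0 < orient p a c := by
    refine lt_of_le_of_ne ?_ hac.symm
    by_contra h
    linarith [hmin c ⟨hc, by linarith⟩]
  refine ⟨a, c, b, ha, hc, hb.1, ?_, ?_, ?_⟩
  · rwa [orient_rot p a c]
  · rw [orient_rot p c b, orient_swap]; linarith
  · rw [orient_rot p b a]; linarith

lemma Inside.wedges {a b c p q : Pt} (h : Inside a b c p) (ha : orient p q a ≠ 0)
    (hb : orient p q b ≠ 0) (hc : orient p q c ≠ 0) :
    (orient p q a < 0 ∧ 0 < orient p q b) ∨ (orient p q b < 0 ∧ 0 < orient p q c) ∨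
      (orient p q c < 0 ∧ 0 < orient p q a) := by
  have e := orient_bary a b c p p q
  rw [orient_self_outer, mul_zero] at e
  rcases lt_or_gt_of_ne ha with ha | ha <;> rcases lt_or_gt_of_ne hb with hb | hb <;>
    rcases lt_or_gt_of_ne hc with hc | hc <;> try tauto
  · linarith [mul_neg_of_pos_of_neg h.2.1 ha, mul_neg_of_pos_of_neg h.2.2 hb,
      mul_neg_of_pos_of_neg h.1 hc]
  · linarith [mul_pos h.2.1 ha, mul_pos h.2.2 hb, mul_pos h.1 hc]

/-- The quadrilateral `p a q b` formed by three neighbours of `p` is strictly convex. -/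
structure Ear (T : Finset (Sym2 Pt)) (p a q b : Pt) : Prop where
  left : s(p, a) ∈ T
  mid : s(p, q) ∈ T
  right : s(p, b) ∈ T
  paq : 0 < orient p a q
  pqb : 0 < orient p q b
  pab : 0 < orient p a b
  abq : orient a b q < 0

lemma Triang.exists_ear (gp : Generic P) (hT : Triang P T) {p : Pt} (hp : p ∈ P)
    (hs : Surrounded P p) (hd : 4 ≤ (nb P T p).card) : ∃ a q b, Ear T p a q b := by
  obtain ⟨a, b, c, ha, hb, hc, hin⟩ := hT.exists_inside gp hp hs
  obtain ⟨q, hq, hqn⟩ : ∃ q ∈ nb P T p, q ∉ ({a, b, c} : Finset Pt) := by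
    by_contra h
    push Not at h
    have := (Finset.card_le_card h).trans Finset.card_le_three
    omega
  simp only [Finset.mem_insert, Finset.mem_singleton, not_or] at hqn
  rw [hT.mem_nb] at hq
  have hqP := hT.right_mem hq
  have wedge : ∀ {a b c : Pt}, s(p, a) ∈ T → s(p, b) ∈ T → s(p, c) ∈ T → Inside a b c p →
      q ≠ a → q ≠ b → q ≠ c → orient p q a < 0 → 0 < orient p q b →
      ∃ a q b, Ear T p a q b := by
    intro a b c ha hb hc hin hqa hqb hqc h1 h2
    have k1 : 0 < orient p a b := by rw [← orient_rot p a b]; exact hin.1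
    have k2 : 0 < orient p b c := by rw [← orient_rot p b c]; exact hin.2.1
    have k3 : 0 < orient p c a := by rw [← orient_rot p c a]; exact hin.2.2
    have haq : 0 < orient p a q := by rw [orient_swap]; linarith
    have hbq : 0 < orient b p q := by rw [orient_swap' p b q, orient_swap p q b]; linarith
    have hab : a ≠ b := by rintro rfl; simp at k1
    have n1 := gp a (hT.right_mem ha) b (hT.right_mem hb) q hqP hab (Ne.symm hqa) (Ne.symm hqb)
    rcases lt_or_gt_of_ne n1 with h3 | h3
    · exact ⟨a, q, b, ha, hq, hb, haq, h2, k1, h3⟩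
    have habc := hin.orient_pos
    have n2 := gp p hp q hqP c (hT.right_mem hc) (hT.ne hq) (hT.ne hc) hqc
    rcases lt_or_gt_of_ne n2 with h4 | h4
    · have e := orient_bary p a b q a c
      have s1 : orient a c p = -orient p c a := by rw [orient_rot p a c, orient_swap]
      have s2 : orient a c b = -orient a b c := orient_swap a b c
      rw [orient_self_outer, mul_zero, add_zero, s1, s2] at e
      refine ⟨c, a, q, hc, ha, hq, k3, haq, by rw [orient_swap]; linarith, ?_⟩
      rw [orient_rot a c q]
      by_contra h5
      nlinarith [mul_pos h3 k3, mul_pos haq habc, mul_nonneg k1.le (not_lt.1 h5)]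
    · have e := orient_bary p a b q c b
      have s1 : orient c b p = -orient p b c := by rw [orient_rot p c b, orient_swap]
      have s2 : orient c b a = -orient a b c := by rw [orient_swap', orient_rot]
      rw [orient_self_right, mul_zero, add_zero, s1, s2] at e
      refine ⟨q, b, c, hq, hb, hc, h2, k2, h4, ?_⟩
      rw [← orient_rot q c b]
      by_contra h5
      nlinarith [mul_pos h3 k2, mul_pos hbq habc, mul_nonneg k1.le (not_lt.1 h5)]
  have n : ∀ x, s(p, x) ∈ T → q ≠ x → orient p q x ≠ 0 := fun x hx hqx =>
    gp p hp q hqP x (hT.right_mem hx) (hT.ne hq) (hT.ne hx) hqx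
  rcases hin.wedges (n a ha hqn.1) (n b hb hqn.2.1) (n c hc hqn.2.2) with h | h | h
  · exact wedge ha hb hc hin hqn.1 hqn.2.1 hqn.2.2 h.1 h.2
  · exact wedge hb hc ha hin.rot hqn.2.1 hqn.2.2 hqn.1 h.1 h.2
  · exact wedge hc ha hb hin.rot.rot hqn.2.2 hqn.1 hqn.2.1 h.1 h.2

lemma orient_pluecker (p a b c d : Pt) : orient p a c * orient p b d
    = orient p a b * orient p c d + orient p a d * orient p b c := by
  simp only [orient]; ring

lemma orient_pos_of_mid {p a r b c : Pt} (h0 : 0 < orient p r b) (h1 : 0 < orient p a r)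
    (h2 : 0 < orient p c b) (h3 : 0 < orient p a b) (h4 : 0 < orient p r c) :
    0 < orient p a c :=
  pos_of_mul_pos_left (by rw [orient_pluecker]; positivity : 0 < orient p a c * orient p r b)
    h0.le

lemma orient_pos_of_mid' {p a r b c : Pt} (h0 : 0 < orient p a r) (h1 : 0 < orient p r b)
    (h2 : 0 < orient p a c) (h3 : 0 < orient p a b) (h4 : 0 < orient p c r) :
    0 < orient p c b :=
  pos_of_mul_pos_right (by rw [orient_pluecker]; positivity : 0 < orient p a r * orient p c b)
    h0.le

/-- An ear may be chosen such that its three vertices are angularly consecutive. -/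
lemma Triang.exists_consecutive_ear (gp : Generic P) (hT : Triang P T) {p a q b : Pt}
    (h : Ear T p a q b) : ∃ a q b, Ear T p a q b ∧
      (∀ c, s(p, c) ∈ T → ¬ (0 < orient p a c ∧ 0 < orient q p c)) ∧
      (∀ c, s(p, c) ∈ T → ¬ (0 < orient p q c ∧ 0 < orient b p c)) := by
  have hp := hT.left_mem h.left
  let W : Pt → Pt → Finset Pt := fun a b =>
    (nb P T p).filter fun c => 0 < orient p a c ∧ 0 < orient p c b
  have hW : ∀ a b c, c ∈ W a b ↔ s(p, c) ∈ T ∧ 0 < orient p a c ∧ 0 < orient p c b := by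
    intro a b c
    simp only [W, Finset.mem_filter, hT.mem_nb]
  have rev : ∀ a c, orient a p c = orient p c a := fun a c => orient_rot a p c |>.symm
  simp only [rev]
  induction hn : (W a b).card using Nat.strong_induction_on generalizing a q b with
  | _ n ih =>
  subst hn
  have haP := hT.right_mem h.left
  have hqP := hT.right_mem h.mid
  have hbP := hT.right_mem h.right
  have haq : a ≠ q := by rintro rfl; have := h.paq; simp at this
  have hqb : q ≠ b := by rintro rfl; have := h.pqb; simp at this
  have less : ∀ {a' b' r}, r ∈ W a b → r ∉ W a' b' → W a' b' ⊆ W a b →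
      (W a' b').card < (W a b).card := fun h1 h2 h3 =>
    Finset.card_lt_card ⟨h3, fun h4 => h2 (h4 h1)⟩
  by_cases c1 : ∃ r, s(p, r) ∈ T ∧ 0 < orient p a r ∧ 0 < orient p r q
  · obtain ⟨r, hr, h1, h2⟩ := c1
    have hra : a ≠ r := by rintro rfl; simp at h1
    have hrq : q ≠ r := by rintro rfl; simp at h2
    have hrb : 0 < orient p r b := orient_pos_of_mid' h.paq h.pqb h1 h.pab h2
    rcases lt_or_gt_of_ne (gp a haP q hqP r (hT.right_mem hr) haq hra hrq) with h3 | h3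
    · refine ih _ (less (r := q) ((hW _ _ _).2 ⟨h.mid, h.paq, h.pqb⟩) ?_ ?_)
        ⟨h.left, hr, h.mid, h1, h2, h.paq, h3⟩ rfl
      · simp [hW]
      · intro c hc
        rw [hW] at hc ⊢
        exact ⟨hc.1, hc.2.1, orient_pos_of_mid' h.paq h.pqb hc.2.1 h.pab hc.2.2⟩
    · refine ih _ (less (a' := r) (b' := b) (r := r) ((hW _ _ _).2 ⟨hr, h1, hrb⟩) ?_ ?_)
        ⟨hr, h.mid, h.right, h2, h.pqb, hrb, ?_⟩ rfl
      · simp [hW]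
      · intro c hc
        rw [hW] at hc ⊢
        exact ⟨hc.1, orient_pos_of_mid hrb h1 hc.2.2 h.pab hc.2.1, hc.2.2⟩
      · have e := orient_bary p a q r b q
        have s1 : orient b q p = -orient p q b := by rw [orient_rot p b q, orient_swap]
        have s2 : orient b q a = orient a b q := orient_rot a b q
        rw [orient_self_right, mul_zero, add_zero, s1, s2, rev q r] at e
        rw [← orient_rot r b q]
        by_contra h5
        nlinarith [mul_pos h3 h.pqb, mul_pos_of_neg_of_neg h.abq (neg_lt_zero.2 h2),
          mul_nonneg h.paq.le (not_lt.1 h5)]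
  by_cases c2 : ∃ r, s(p, r) ∈ T ∧ 0 < orient p q r ∧ 0 < orient p r b
  · obtain ⟨r, hr, h1, h2⟩ := c2
    have hrq : q ≠ r := by rintro rfl; simp at h1
    have hrb : b ≠ r := by rintro rfl; simp at h2
    have har : 0 < orient p a r := orient_pos_of_mid h.pqb h.paq h2 h.pab h1
    rcases lt_or_gt_of_ne (gp q hqP b hbP r (hT.right_mem hr) hqb hrq hrb) with h3 | h3
    · refine ih _ (less (r := q) ((hW _ _ _).2 ⟨h.mid, h.paq, h.pqb⟩) ?_ ?_)
        ⟨h.mid, hr, h.right, h1, h2, h.pqb, h3⟩ rfl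
      · simp [hW]
      · intro c hc
        rw [hW] at hc ⊢
        exact ⟨hc.1, orient_pos_of_mid h.pqb h.paq hc.2.2 h.pab hc.2.1, hc.2.2⟩
    · refine ih _ (less (a' := a) (b' := r) (r := r) ((hW _ _ _).2 ⟨hr, har, h2⟩) ?_ ?_)
        ⟨h.left, h.mid, hr, h.paq, h1, har, ?_⟩ rfl
      · simp [hW]
      · intro c hc
        rw [hW] at hc ⊢
        exact ⟨hc.1, hc.2.1, orient_pos_of_mid' har h2 hc.2.1 h.pab hc.2.2⟩
      · have e := orient_bary p q b r q a
        have s1 : orient q a p = -orient p a q := by rw [orient_rot p q a, orient_swap]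
        have s2 : orient q a b = orient a b q := (orient_rot q a b).symm
        rw [orient_self_outer, mul_zero, add_zero, s1, s2] at e
        rw [orient_rot q a r]
        by_contra h5
        nlinarith [mul_pos h3 h.paq, mul_pos_of_neg_of_neg h.abq (neg_lt_zero.2 h1),
          mul_nonneg h.pqb.le (not_lt.1 h5)]
  exact ⟨a, q, b, h, fun c hc h' => c1 ⟨c, hc, h'⟩, fun c hc h' => c2 ⟨c, hc, h'⟩⟩

/-- Two empty triangles `p a q` and `p q b` of `T` whose union is strictly convex. -/
structure Diamond (P : Finset Pt) (T : Finset (Sym2 Pt)) (p a q b : Pt) : Prop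
    extends Ear T p a q b where
  aq : s(a, q) ∈ T
  qb : s(q, b) ∈ T
  empty_left : ∀ c ∈ P, ¬ Inside p a q c
  empty_right : ∀ c ∈ P, ¬ Inside p q b c

lemma Triang.exists_diamond (gp : Generic P) (hT : Triang P T) {p : Pt} (hp : p ∈ P)
    (hs : Surrounded P p) (hd : 4 ≤ (nb P T p).card) : ∃ a q b, Diamond P T p a q b := by
  obtain ⟨a, q, b, h⟩ := hT.exists_ear gp hp hs hd
  obtain ⟨a, q, b, h, h1, h2⟩ := hT.exists_consecutive_ear gp h
  obtain ⟨h3, h4⟩ := hT.consecutive gp h.left h.mid h.paq h1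
  obtain ⟨h5, h6⟩ := hT.consecutive gp h.mid h.right h.pqb h2
  exact ⟨a, q, b, h, h3, h5, h4, h6⟩

lemma Ear.crosses {p a q b : Pt} (h : Ear T p a q b) : Crosses p q a b := by
  constructor
  · rw [orient_swap]
    exact mul_neg_of_neg_of_pos (by linarith [h.paq]) h.pqb
  · rw [orient_rot p a b]
    exact mul_neg_of_pos_of_neg h.pab h.abq

lemma Ear.aqb {p a q b : Pt} (h : Ear T p a q b) : 0 < orient a q b := by
  rw [orient_swap]; linarith [h.abq]

/-- The diagonal `p q` of a diamond is the only edge crossing the other diagonal. -/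
lemma Diamond.eq_of_crosses (gp : Generic P) (hT : Triang P T) {p a q b u v : Pt}
    (h : Diamond P T p a q b) (huv : s(u, v) ∈ T) (hX : Crosses a b u v) : s(p, q) = s(u, v) := by
  obtain ⟨s, t, hs0, hs1, ht0, ht1, he⟩ := hX.exists_point
  have hs1' : 0 < 1 - s := by linarith
  have f1 : 0 < orient p a (lin s a b) := by
    rw [orient_lin, orient_self_right, mul_zero, zero_add]; exact mul_pos hs0 h.pab
  have f2 : 0 < orient b p (lin s a b) := by
    rw [orient_lin, orient_self_outer, mul_zero, add_zero, orient_rot a b p, orient_rot p a b]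
    exact mul_pos hs1' h.pab
  have f3 : 0 < orient a q (lin s a b) := by
    rw [orient_lin, orient_self_outer, mul_zero, zero_add]; exact mul_pos hs0 h.aqb
  have f4 : 0 < orient q b (lin s a b) := by
    rw [orient_lin, orient_self_right, mul_zero, add_zero, orient_rot a q b]
    exact mul_pos hs1' h.aqb
  rcases lt_trichotomy (orient p q (lin s a b)) 0 with g | g | g
  · refine absurd ?_ (hT.not_inside gp h.left h.aq (Sym2.eq_swap ▸ h.mid) h.empty_left huv
      ht0 ht1)
    rw [← he]
    exact ⟨f1, f3, by rw [orient_swap']; linarith⟩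
  · obtain ⟨r, hr⟩ := exists_lin_of_orient_eq_zero (hT.ne h.mid) g
    rw [hr, orient_lin, orient_self_outer, mul_zero, zero_add] at f1
    rw [hr, orient_lin, orient_self_right, mul_zero, add_zero, orient_rot p a q] at f3
    have hr0 : 0 < r := pos_of_mul_pos_left f1 h.paq.le
    have hr1 : 0 < 1 - r := pos_of_mul_pos_left f3 h.paq.le
    exact (crosses_or_eq gp (hT.left_mem h.mid) (hT.right_mem h.mid) (hT.left_mem huv)
      (hT.right_mem huv) (hT.ne h.mid) (hT.ne huv) hr0 (by linarith) ht0 ht1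
      (hr.symm.trans he)).resolve_left (hT.not_crosses h.mid huv)
  · refine absurd ?_ (hT.not_inside gp h.mid h.qb (Sym2.eq_swap ▸ h.right) h.empty_right huv
      ht0 ht1)
    rw [← he]
    exact ⟨g, f4, f2⟩

lemma Diamond.empty_near (gp : Generic P) (hT : Triang P T) {p a q b c : Pt}
    (h : Diamond P T p a q b) (hc : c ∈ P) : ¬ Inside p a b c := by
  rintro ⟨h1, h2, h3⟩
  have hpc : p ≠ c := by rintro rfl; simp at h1
  have hqc : q ≠ c := by rintro rfl; linarith [h.abq]
  rcases lt_or_gt_of_ne (gp p (hT.left_mem h.mid) q (hT.right_mem h.mid) c hc (hT.ne h.mid)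
    hpc hqc) with g | g
  · have e := orient_bary p a b c a q
    rw [orient_self_outer, mul_zero, add_zero, orient_rot p a q] at e
    refine h.empty_left c hc ⟨h1, ?_, by rw [orient_swap']; linarith⟩
    exact pos_of_mul_pos_right (e ▸ add_pos (mul_pos h2 h.paq) (mul_pos h1 h.aqb)) h.pab.le
  · have e := orient_bary p a b c q b
    rw [orient_self_right, mul_zero, add_zero, orient_rot p q b, orient_rot a q b] at e
    refine h.empty_right c hc ⟨g, ?_, h3⟩
    exact pos_of_mul_pos_right (e ▸ add_pos (mul_pos h2 h.pqb) (mul_pos h3 h.aqb)) h.pab.le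

lemma Diamond.empty_far (gp : Generic P) (hT : Triang P T) {p a q b c : Pt}
    (h : Diamond P T p a q b) (hc : c ∈ P) : ¬ Inside a q b c := by
  rintro ⟨h1, h2, h3⟩
  have hqc : q ≠ c := by rintro rfl; simp at h1
  have hpc : p ≠ c := by
    rintro rfl
    rw [orient_swap', orient_rot] at h3
    linarith [h.pab]
  rcases lt_or_gt_of_ne (gp p (hT.left_mem h.mid) q (hT.right_mem h.mid) c hc (hT.ne h.mid)
    hpc hqc) with g | g
  · have e := orient_bary a q b c p a
    rw [orient_self_right, mul_zero, zero_add] at e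
    refine h.empty_left c hc ⟨?_, h1, by rw [orient_swap']; linarith⟩
    exact pos_of_mul_pos_right (e ▸ add_pos (mul_pos h3 h.paq) (mul_pos h1 h.pab)) h.aqb.le
  · have e := orient_bary a q b c b p
    rw [orient_self_outer, mul_zero, add_zero, orient_rot a b p, orient_rot p a b,
      orient_rot q b p, orient_rot p q b] at e
    refine h.empty_right c hc ⟨g, h2, ?_⟩
    exact pos_of_mul_pos_right (e ▸ add_pos (mul_pos h2 h.pab) (mul_pos h3 h.pqb)) h.aqb.le

lemma Diamond.triang_flip (gp : Generic P) (hT : Triang P T) {p a q b : Pt}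
    (h : Diamond P T p a q b) : Triang P (insert s(a, b) (T.erase s(p, q))) := by
  have haP := hT.right_mem h.left
  have hbP := hT.right_mem h.right
  have hab : a ≠ b := by rintro rfl; have := h.pab; simp at this
  have hpa : p ≠ a := hT.ne h.left
  have hpb : p ≠ b := hT.ne h.right
  have hpl : Plane P (insert s(a, b) (T.erase s(p, q))) := by
    refine (hT.toPlane.mono (Finset.erase_subset _ _)).insert_edge haP hbP hab ?_
    intro c d hcd hX
    rw [Finset.mem_erase] at hcd
    exact hcd.1 (h.eq_of_crosses gp hT hcd.2 hX).symm
  refine ⟨hpl, ?_⟩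
  intro u v hu hv huv hX
  by_contra hn
  rw [Finset.mem_insert, Finset.mem_erase, not_or] at hn
  have hpq : s(u, v) ≠ s(p, q) := by
    intro e
    exact hX a b (Finset.mem_insert_self _ _) ((h.crosses.symm.congr_right e.symm).symm)
  obtain ⟨c, d, hcd, hc⟩ := hT.exists_crossing hu hv huv (fun h' => hn.2 ⟨hpq, h'⟩)
  have hcd' : s(c, d) = s(p, q) := by
    by_contra hne
    exact hX c d (Finset.mem_insert_of_mem (Finset.mem_erase.2 ⟨hne, hcd⟩)) hc
  have hc := hc.congr_right hcd'
  obtain ⟨t, r, ht0, ht1, hr0, hr1, he⟩ := hc.exists_point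
  have hr1' : 0 < 1 - r := by linarith
  have hG := hpl.insert_edge hu hv huv hX
  have f1 : 0 < orient p a (lin r p q) := by
    rw [orient_lin, orient_self_outer, mul_zero, zero_add]; exact mul_pos hr0 h.paq
  have f2 : 0 < orient b p (lin r p q) := by
    rw [orient_lin, orient_self_right, mul_zero, zero_add, orient_rot q b p, orient_rot p q b]
    exact mul_pos hr0 h.pqb
  have f3 : 0 < orient a q (lin r p q) := by
    rw [orient_lin, orient_self_right, mul_zero, add_zero, orient_rot p a q]
    exact mul_pos hr1' h.paq
  have f4 : 0 < orient q b (lin r p q) := by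
    rw [orient_lin, orient_self_outer, mul_zero, add_zero, orient_rot p q b]
    exact mul_pos hr1' h.pqb
  have mem : ∀ {x y : Pt}, s(x, y) ∈ T → s(x, y) ≠ s(p, q) →
      s(x, y) ∈ insert s(u, v) (insert s(a, b) (T.erase s(p, q))) := fun h1 h2 =>
    Finset.mem_insert_of_mem (Finset.mem_insert_of_mem (Finset.mem_erase.2 ⟨h2, h1⟩))
  have haq : a ≠ q := hT.ne h.aq
  have hqb : q ≠ b := hT.ne h.qb
  have hab' : s(a, b) ∈ insert s(u, v) (insert s(a, b) (T.erase s(p, q))) := by simp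
  have hba' : s(b, a) ∈ insert s(u, v) (insert s(a, b) (T.erase s(p, q))) := by
    rw [Sym2.eq_swap (a := b)]; exact hab'
  rw [← he] at f1 f2 f3 f4
  rcases lt_trichotomy (orient a b (lin t u v)) 0 with g | g | g
  · refine hG.not_inside gp (mem h.aq ?_) (mem h.qb ?_) hba'
      (fun c hc => h.empty_far gp hT hc) (Finset.mem_insert_self _ _) ht0 ht1
      ⟨f3, f4, by rw [orient_swap']; linarith⟩
    · simp [hpa.symm, haq]
    · simp [hpb.symm, hqb.symm]
  · obtain ⟨w, hw⟩ := exists_lin_of_orient_eq_zero hab g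
    rw [hw, orient_lin, orient_self_right, mul_zero, zero_add] at f1
    rw [hw, orient_lin, orient_self_outer, mul_zero, add_zero, orient_rot a b p,
      orient_rot p a b] at f2
    have hw0 : 0 < w := pos_of_mul_pos_left f1 h.pab.le
    have hw1 : 0 < 1 - w := pos_of_mul_pos_left f2 h.pab.le
    rcases crosses_or_eq gp hu hv haP hbP huv hab ht0 ht1 hw0 (by linarith) hw with h' | h'
    · exact hX a b (Finset.mem_insert_self _ _) h'
    · exact hn.1 h'
  · refine hG.not_inside gp (mem h.left ?_) hab' (mem (Sym2.eq_swap ▸ h.right) ?_)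
      (fun c hc => h.empty_near gp hT hc) (Finset.mem_insert_self _ _) ht0 ht1 ⟨f1, g, f2⟩
    · simp [haq, hpa.symm]
    · simp [hpb.symm, hqb.symm]

/-- An interior vertex of degree at least four can lose an edge by a flip. -/
lemma Triang.exists_flip (gp : Generic P) (hT : Triang P T) {p : Pt} (hp : p ∈ P)
    (hs : Surrounded P p) (hd : 4 ≤ (nb P T p).card) :
    ∃ T' e q, Triang P T' ∧ q ∈ nb P T p ∧ nb P T' p = (nb P T p).erase q ∧
      T' = insert e (T.erase s(p, q)) ∧ e ∉ T ∧
      e ∈ (nb P T' p).offDiag.image (fun x => s(x.1, x.2)) := by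
  obtain ⟨a, q, b, h⟩ := hT.exists_diamond gp hp hs hd
  have hab : a ≠ b := by rintro rfl; have := h.pab; simp at this
  have hpa : p ≠ a := hT.ne h.left
  have hpb : p ≠ b := hT.ne h.right
  have hnb : nb P (insert s(a, b) (T.erase s(p, q))) p = (nb P T p).erase q := by
    ext c
    simp only [nb, Finset.mem_filter, Finset.mem_insert, Finset.mem_erase, Sym2.eq_iff, ne_eq]
    constructor
    · rintro ⟨h1, (⟨h2, -⟩ | ⟨h2, -⟩) | ⟨h2, h3⟩⟩
      · exact absurd h2 hpa
      · exact absurd h2 hpb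
      · exact ⟨fun h4 => h2 (Or.inl ⟨trivial, h4⟩), h1, h3⟩
    · rintro ⟨h1, h2, h3⟩
      refine ⟨h2, Or.inr ⟨?_, h3⟩⟩
      rintro (h4 | ⟨h4, h5⟩)
      · exact h1 h4.2
      · exact h1 (h5.trans h4)
  refine ⟨_, s(a, b), q, h.triang_flip gp hT, hT.mem_nb.2 h.mid, hnb, rfl, ?_, ?_⟩
  · exact fun h' => hT.not_crosses h.mid h' h.crosses
  · rw [Finset.mem_image]
    refine ⟨(a, b), ?_, rfl⟩
    rw [Finset.mem_offDiag, hnb, Finset.mem_erase, Finset.mem_erase, hT.mem_nb, hT.mem_nb]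
    exact ⟨⟨hT.ne h.aq, h.left⟩, ⟨(hT.ne h.qb).symm, h.right⟩, hab⟩

/-- A flip is determined by its result. -/
lemma Triang.flip_injective {T T' : Finset (Sym2 Pt)} (hT : Triang P T) (hT' : Triang P T')
    {p q q' : Pt} {e : Sym2 Pt} (hp : p ∈ P) (hq : q ∈ nb P T p) (hq' : q' ∈ nb P T' p)
    (he : e ∉ T) (he' : e ∉ T')
    (h : insert e (T.erase s(p, q)) = insert e (T'.erase s(p, q'))) : T = T' := by
  rw [hT.mem_nb] at hq
  rw [hT'.mem_nb] at hq'
  have h2 : T.erase s(p, q) = T'.erase s(p, q') := by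
    rw [← Finset.erase_insert (a := e) (s := T.erase s(p, q)) (by simp [he]), h,
      Finset.erase_insert (by simp [he'])]
  by_cases hqq : s(p, q) = s(p, q')
  · rw [← Finset.insert_erase hq, ← Finset.insert_erase hq', h2, hqq]
  exfalso
  have hn : s(p, q') ∉ T := by
    intro hm
    have := Finset.mem_erase.2 ⟨Ne.symm hqq, hm⟩
    rw [h2] at this
    simp at this
  obtain ⟨c, d, hcd, hX⟩ := hT.exists_crossing hp (hT'.right_mem hq') (hT'.ne hq') hn
  by_cases hcd' : s(c, d) = s(p, q)
  · have := (hX.congr_right hcd').1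
    simp at this
  · have := Finset.mem_erase.2 ⟨hcd', hcd⟩
    rw [h2] at this
    exact hT'.not_crosses hq' (Finset.mem_of_mem_erase this) hX

/-- The edges of `T` that avoid the vertex `p`. -/
def del (T : Finset (Sym2 Pt)) (p : Pt) : Finset (Sym2 Pt) := T.filter fun e => p ∉ e

lemma mem_del {p : Pt} {e : Sym2 Pt} : e ∈ del T p ↔ e ∈ T ∧ p ∉ e := Finset.mem_filter

lemma Plane.plane_del (hG : Plane P G) (p : Pt) : Plane (P.erase p) (del G p) := by
  refine ⟨fun h => hG.ne (mem_del.1 h).1, fun h => ?_, fun h h' =>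
    hG.not_crosses (mem_del.1 h).1 (mem_del.1 h').1⟩
  rw [mem_del] at h
  refine Finset.mem_erase.2 ⟨?_, hG.left_mem h.1⟩
  rintro rfl
  exact h.2 (Sym2.mem_mk_left _ _)

lemma Plane.card_incident (hG : Plane P G) (p : Pt) :
    (G.filter fun e => p ∈ e).card = (nb P G p).card := by
  symm
  refine Finset.card_bij (fun c _ => s(p, c)) ?_ ?_ ?_
  · intro c hc
    simpa using hG.mem_nb.1 hc
  · intro c _ d _ h
    exact Sym2.congr_right.1 h
  · intro e he
    rw [Finset.mem_filter] at he
    obtain ⟨c, rfl⟩ := Sym2.mem_iff_exists.1 he.2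
    exact ⟨c, hG.mem_nb.2 he.1, rfl⟩

lemma Plane.card_del (hG : Plane P G) (p : Pt) :
    (del G p).card + (nb P G p).card = G.card := by
  rw [← hG.card_incident p, del, add_comm]
  exact Finset.card_filter_add_card_filter_not _

/-- An interior vertex has at least three neighbours. -/
lemma Triang.three_le_degree (gp : Generic P) (hT : Triang P T) {p : Pt} (hp : p ∈ P)
    (hs : Surrounded P p) : 3 ≤ (nb P T p).card := by
  obtain ⟨a, b, c, ha, hb, hc, h⟩ := hT.exists_inside gp hp hs
  rw [← Finset.card_eq_three.2 ⟨a, b, c, ?_, ?_, ?_, rfl⟩]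
  · apply Finset.card_le_card
    intro x hx
    simp only [Finset.mem_insert, Finset.mem_singleton] at hx
    rw [hT.mem_nb]
    rcases hx with rfl | rfl | rfl <;> assumption
  · rintro rfl; have := h.orient_pos; simp at this
  · rintro rfl; have := h.orient_pos; simp at this
  · rintro rfl; have := h.orient_pos; simp at this

lemma Inside.ne_left {a b c x : Pt} (h : Inside a b c x) : a ≠ x := by
  rintro rfl; have := h.1; simp at this

/-- Removing an interior vertex of degree three leaves a triangulation. -/
lemma Triang.triang_del (gp : Generic P) (hT : Triang P T) {p : Pt} (hp : p ∈ P)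
    (hs : Surrounded P p) (hd : (nb P T p).card = 3) : Triang (P.erase p) (del T p) := by
  obtain ⟨a, b, c, ha, hb, hc, hin⟩ := hT.exists_inside gp hp hs
  have hpos := hin.orient_pos
  have hnb : ∀ n, s(p, n) ∈ T → n = a ∨ n = b ∨ n = c := by
    have hsub : ({a, b, c} : Finset Pt) ⊆ nb P T p := by
      intro x hx
      simp only [Finset.mem_insert, Finset.mem_singleton] at hx
      rw [hT.mem_nb]
      rcases hx with rfl | rfl | rfl <;> assumption
    have hcard : ({a, b, c} : Finset Pt).card = 3 := by
      refine Finset.card_eq_three.2 ⟨a, b, c, ?_, ?_, ?_, rfl⟩ <;> rintro rfl <;> simp at hpos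
    have := Finset.eq_of_subset_of_card_le hsub (by omega)
    intro n hn
    have hm := hT.mem_nb.2 hn
    rw [← this] at hm
    simpa using hm
  have wedge : ∀ {a b c : Pt}, s(p, a) ∈ T → s(p, b) ∈ T → Inside a b c p →
      (∀ n, s(p, n) ∈ T → n = a ∨ n = b ∨ n = c) →
      s(a, b) ∈ T ∧ ∀ x ∈ P, ¬ Inside p a b x := by
    intro a b c ha hb hin hnb
    refine hT.consecutive gp ha hb (by rw [← orient_rot p a b]; exact hin.1) fun n hn h => ?_
    rcases hnb n hn with rfl | rfl | rfl
    · simpa using h.1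
    · simpa using h.2
    · have h1 := h.1
      rw [orient_swap, ← orient_rot p n a] at h1
      linarith [hin.2.2]
  obtain ⟨hab, eab⟩ := wedge ha hb hin hnb
  obtain ⟨hbc, ebc⟩ := wedge hb hc hin.rot fun n hn => by have := hnb n hn; tauto
  obtain ⟨hca, eca⟩ := wedge hc ha hin.rot.rot fun n hn => by have := hnb n hn; tauto
  have empty : ∀ x ∈ P.erase p, ¬ Inside a b c x := by
    intro x hx h
    rw [Finset.mem_erase] at hx
    have n : ∀ {y : Pt}, s(p, y) ∈ T → y ≠ x → orient p x y ≠ 0 := fun hy hyx =>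
      gp p hp x hx.2 _ (hT.right_mem hy) hx.1.symm (hT.ne hy) hyx.symm
    have close : ∀ {a b : Pt}, (∀ x ∈ P, ¬ Inside p a b x) → 0 < orient a b x →
        orient p x a < 0 → 0 < orient p x b → False := by
      intro a b e h1 h2 h3
      refine e x hx.2 ⟨by rw [orient_swap]; linarith, h1, ?_⟩
      rwa [← orient_rot b p x]
    rcases hin.wedges (n ha h.ne_left) (n hb h.rot.ne_left) (n hc h.rot.rot.ne_left) with
      h' | h' | h'
    · exact close eab h.1 h'.1 h'.2
    · exact close ebc h.2.1 h'.1 h'.2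
    · exact close eca h.2.2 h'.1 h'.2
  refine ⟨hT.toPlane.plane_del p, ?_⟩
  intro u v hu hv huv hX
  rw [mem_del]
  have hup := Finset.ne_of_mem_erase hu
  have hvp := Finset.ne_of_mem_erase hv
  refine ⟨?_, by simp [hup.symm, hvp.symm]⟩
  by_contra hn
  obtain ⟨x, y, hxy, hc'⟩ := hT.exists_crossing (Finset.mem_of_mem_erase hu)
    (Finset.mem_of_mem_erase hv) huv hn
  have hpxy : p ∈ s(x, y) := by
    by_contra h
    exact hX x y (mem_del.2 ⟨hxy, h⟩) hc'
  obtain ⟨n, hpn⟩ := Sym2.mem_iff_exists.1 hpxy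
  have hc' := hc'.congr_right hpn
  rw [hpn] at hxy
  obtain ⟨t, r, ht0, ht1, hr0, hr1, he⟩ := hc'.exists_point
  have hr1' : 0 < 1 - r := by linarith
  have inside : Inside a b c (lin t u v) := by
    rw [he]
    refine ⟨?_, ?_, ?_⟩ <;> rw [orient_lin]
    · have : 0 ≤ orient a b n := by
        rcases hnb n hxy with rfl | rfl | rfl <;> simp [hpos.le]
      linarith [mul_pos hr1' hin.1, mul_nonneg hr0.le this]
    · have : 0 ≤ orient b c n := by
        rcases hnb n hxy with rfl | rfl | rfl
        · exact (orient_rot n b c).symm ▸ hpos.le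
        · simp
        · simp
      linarith [mul_pos hr1' hin.2.1, mul_nonneg hr0.le this]
    · have : 0 ≤ orient c a n := by
        rcases hnb n hxy with rfl | rfl | rfl
        · simp
        · exact (orient_rot n c a).symm ▸ (orient_rot a n c).symm ▸ hpos.le
        · simp
      linarith [mul_pos hr1' hin.2.2, mul_nonneg hr0.le this]
  have mem : ∀ {x y : Pt}, s(x, y) ∈ T → s(p, x) ∈ T → s(p, y) ∈ T →
      s(x, y) ∈ insert s(u, v) (del T p) := fun h hx hy =>
    Finset.mem_insert_of_mem (mem_del.2 ⟨h, by simp [hT.ne hx, hT.ne hy]⟩)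
  exact ((hT.toPlane.plane_del p).insert_edge hu hv huv hX).not_inside
    (gp.mono (Finset.erase_subset _ _)) (mem hab ha hb) (mem hbc hb hc) (mem hca hc ha) empty
    (Finset.mem_insert_self _ _) ht0 ht1 inside

lemma Triang.del_injective {T T' : Finset (Sym2 Pt)} (hT : Triang P T) (hT' : Triang P T')
    {p : Pt} (h : del T p = del T' p) : T = T' := by
  have key : ∀ {T T' : Finset (Sym2 Pt)}, Triang P T → Triang P T' →
      del T p = del T' p → T ⊆ T' := by
    intro T T' hT hT' h e he
    by_contra hn
    have hpe : p ∈ e := by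
      by_contra hpe
      have := mem_del.2 ⟨he, hpe⟩
      rw [h, mem_del] at this
      exact hn this.1
    obtain ⟨n, rfl⟩ := Sym2.mem_iff_exists.1 hpe
    obtain ⟨c, d, hcd, hX⟩ := hT'.exists_crossing (hT.left_mem he) (hT.right_mem he) (hT.ne he) hn
    by_cases hpcd : p ∈ s(c, d)
    · obtain ⟨m, hm⟩ := Sym2.mem_iff_exists.1 hpcd
      have := (hX.congr_right hm).1
      simp at this
    · have := mem_del.2 ⟨hcd, hpcd⟩
      rw [← h, mem_del] at this
      exact hT.not_crosses he this.1 hX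
  exact (key hT hT' h).antisymm (key hT' hT h.symm)

/-- The point set `S` together with three further points. -/
def framed (o₁ o₂ o₃ : Pt) (S : Finset Pt) : Finset Pt := insert o₁ (insert o₂ (insert o₃ S))

/-- The triangle `o₁ o₂ o₃` strictly contains `S`, and adding its corners to `S` keeps
general position. -/
structure Frame (o₁ o₂ o₃ : Pt) (S : Finset Pt) : Prop where
  generic : Generic (framed o₁ o₂ o₃ S)
  pos : 0 < orient o₁ o₂ o₃
  inside : ∀ p ∈ S, Inside o₁ o₂ o₃ p

variable {o₁ o₂ o₃ : Pt} {S : Finset Pt}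

lemma mem_framed {x : Pt} : x ∈ framed o₁ o₂ o₃ S ↔ x = o₁ ∨ x = o₂ ∨ x = o₃ ∨ x ∈ S := by
  simp [framed]

lemma Frame.ne_of_mem (h : Frame o₁ o₂ o₃ S) {p : Pt} (hp : p ∈ S) :
    o₁ ≠ p ∧ o₂ ≠ p ∧ o₃ ≠ p :=
  ⟨(h.inside p hp).ne_left, (h.inside p hp).rot.ne_left, (h.inside p hp).rot.rot.ne_left⟩

lemma Frame.corner_ne (h : Frame o₁ o₂ o₃ S) : o₁ ≠ o₂ ∧ o₁ ≠ o₃ ∧ o₂ ≠ o₃ := by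
  refine ⟨?_, ?_, ?_⟩ <;> rintro rfl <;> have := h.pos <;> simp at this

lemma Frame.framed_erase (h : Frame o₁ o₂ o₃ S) {p : Pt} (hp : p ∈ S) :
    (framed o₁ o₂ o₃ S).erase p = framed o₁ o₂ o₃ (S.erase p) := by
  obtain ⟨h1, h2, h3⟩ := h.ne_of_mem hp
  rw [framed, Finset.erase_insert_of_ne h1, Finset.erase_insert_of_ne h2,
    Finset.erase_insert_of_ne h3, framed]

lemma Frame.erase (h : Frame o₁ o₂ o₃ S) (p : Pt) : Frame o₁ o₂ o₃ (S.erase p) where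
  generic := h.generic.mono <| Finset.insert_subset_insert _ <| Finset.insert_subset_insert _ <|
    Finset.insert_subset_insert _ <| Finset.erase_subset _ _
  pos := h.pos
  inside q hq := h.inside q (Finset.mem_of_mem_erase hq)

lemma Frame.surrounded (h : Frame o₁ o₂ o₃ S) {p : Pt} (hp : p ∈ S) :
    Surrounded (framed o₁ o₂ o₃ S) p :=
  (h.inside p hp).surrounded (by simp [framed]) (by simp [framed]) (by simp [framed])

lemma Triang.mem_of_supporting (hT : Triang P T) {a b : Pt} (ha : a ∈ P) (hb : b ∈ P)
    (hab : a ≠ b) (h : ∀ x ∈ P, 0 ≤ orient a b x) : s(a, b) ∈ T :=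
  hT.maximal ha hb hab fun c d hcd hX =>
    absurd hX.1 (not_lt.2 (mul_nonneg (h c (hT.left_mem hcd)) (h d (hT.right_mem hcd))))

lemma Frame.outer_mem (h : Frame o₁ o₂ o₃ S) (hT : Triang (framed o₁ o₂ o₃ S) T) :
    s(o₁, o₂) ∈ T ∧ s(o₂, o₃) ∈ T ∧ s(o₃, o₁) ∈ T := by
  obtain ⟨h12, h13, h23⟩ := h.corner_ne
  have hp := h.pos
  refine ⟨?_, ?_, ?_⟩
  · refine hT.mem_of_supporting (by simp [framed]) (by simp [framed]) h12 fun x hx => ?_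
    rcases mem_framed.1 hx with rfl | rfl | rfl | hx
    · simp
    · simp
    · exact hp.le
    · exact (h.inside x hx).1.le
  · refine hT.mem_of_supporting (by simp [framed]) (by simp [framed]) h23 fun x hx => ?_
    rcases mem_framed.1 hx with rfl | rfl | rfl | hx
    · exact (orient_rot x o₂ o₃).symm ▸ hp.le
    · simp
    · simp
    · exact (h.inside x hx).2.1.le
  · refine hT.mem_of_supporting (by simp [framed]) (by simp [framed]) h13.symm fun x hx => ?_
    rcases mem_framed.1 hx with rfl | rfl | rfl | hx
    · simp
    · rw [orient_rot, orient_rot]; exact hp.le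
    · simp
    · exact (h.inside x hx).2.2.le

lemma Triang.card_flip {e f : Sym2 Pt} (he : e ∉ T) (hf : f ∈ T) :
    (insert e (T.erase f)).card = T.card := by
  rw [Finset.card_insert_of_notMem (fun h => he (Finset.mem_of_mem_erase h)),
    Finset.card_erase_add_one hf]

lemma Frame.card_le (n : ℕ) : ∀ {S : Finset Pt} {T : Finset (Sym2 Pt)}, S.card = n →
    Frame o₁ o₂ o₃ S → Triang (framed o₁ o₂ o₃ S) T → T.card ≤ 3 * n + 3 := by
  induction n with
  | zero =>
    intro S T hS h hT
    rw [Finset.card_eq_zero] at hS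
    subst hS
    have : T ⊆ {s(o₁, o₂), s(o₂, o₃), s(o₃, o₁)} := by
      intro e he
      induction e with
      | _ a b =>
      have ha := mem_framed.1 (hT.left_mem he)
      have hb := mem_framed.1 (hT.right_mem he)
      have hab := hT.ne he
      simp only [Finset.notMem_empty, or_false] at ha hb
      simp only [Finset.mem_insert, Finset.mem_singleton, Sym2.eq_iff]
      grind
    exact (Finset.card_le_card this).trans Finset.card_le_three
  | succ n ih =>
    intro S T hS h hT
    obtain ⟨p, hp⟩ : S.Nonempty := Finset.card_pos.1 (by omega)
    have hpP : p ∈ framed o₁ o₂ o₃ S := mem_framed.2 (by tauto)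
    have hs := h.surrounded hp
    induction hk : (nb (framed o₁ o₂ o₃ S) T p).card using Nat.strong_induction_on
      generalizing T with
    | _ k ihk =>
    subst hk
    rcases (hT.three_le_degree h.generic hpP hs).eq_or_lt with h3 | h3
    · have hd := hT.triang_del h.generic hpP hs h3.symm
      rw [h.framed_erase hp] at hd
      have h1 := ih (by rw [Finset.card_erase_of_mem hp]; omega) (h.erase p) hd
      have h2 := hT.card_del p
      omega
    · obtain ⟨T', e, q, hT', hq, hnb, rfl, he, -⟩ := hT.exists_flip h.generic hpP hs h3
      rw [← Triang.card_flip he (hT.mem_nb.1 hq)]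
      refine ihk _ ?_ hT' rfl
      rw [hnb]
      exact Finset.card_erase_lt_of_mem hq

lemma Plane.sum_degree (hG : Plane P G) : ∑ p ∈ P, (nb P G p).card = 2 * G.card := by
  have h := Finset.sum_card_bipartiteAbove_eq_sum_card_bipartiteBelow (s := P) (t := G)
    (fun p e => p ∈ e)
  rw [Finset.sum_congr rfl fun p _ => (hG.card_incident p).symm]
  refine h.trans ?_
  rw [Finset.sum_congr rfl (g := fun _ => 2), Finset.sum_const, smul_eq_mul, mul_comm]
  intro e he
  induction e with
  | _ a b =>
  rw [Finset.bipartiteBelow, ← Finset.card_pair (hG.ne he)]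
  congr 1
  ext x
  simp only [Finset.mem_filter, Sym2.mem_iff, Finset.mem_insert, Finset.mem_singleton,
    and_iff_right_iff_imp]
  rintro (rfl | rfl)
  · exact hG.left_mem he
  · exact hG.right_mem he

lemma Frame.sum_degree_le (h : Frame o₁ o₂ o₃ S) (hT : Triang (framed o₁ o₂ o₃ S) T) :
    ∑ p ∈ S, (nb (framed o₁ o₂ o₃ S) T p).card ≤ 6 * S.card := by
  have h1 := hT.sum_degree
  have h2 := Frame.card_le _ rfl h hT
  obtain ⟨h12, h13, h23⟩ := h.corner_ne
  obtain ⟨e1, e2, e3⟩ := h.outer_mem hT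
  have two : ∀ {a b c : Pt}, s(a, b) ∈ T → s(c, a) ∈ T → b ≠ c →
      2 ≤ (nb (framed o₁ o₂ o₃ S) T a).card := by
    intro a b c hb hc hbc
    rw [← Finset.card_pair hbc]
    apply Finset.card_le_card
    intro x hx
    rw [Finset.mem_insert, Finset.mem_singleton] at hx
    rcases hx with rfl | rfl
    · exact hT.mem_nb.2 hb
    · exact hT.mem_nb.2 (Sym2.eq_swap ▸ hc)
  have d1 := two e1 e3 h23
  have d2 := two e2 e1 h13.symm
  have d3 := two e3 e2 h12
  have n1 : o₁ ∉ insert o₂ (insert o₃ S) := by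
    simp only [Finset.mem_insert, not_or]
    exact ⟨h12, h13, fun hm => (h.ne_of_mem hm).1 rfl⟩
  have n2 : o₂ ∉ insert o₃ S := by
    simp only [Finset.mem_insert, not_or]
    exact ⟨h23, fun hm => (h.ne_of_mem hm).2.1 rfl⟩
  have n3 : o₃ ∉ S := fun hm => (h.ne_of_mem hm).2.2 rfl
  have hsum : ∀ f : Pt → ℕ, ∑ p ∈ framed o₁ o₂ o₃ S, f p
      = f o₁ + (f o₂ + (f o₃ + ∑ p ∈ S, f p)) := by
    intro f
    rw [framed, Finset.sum_insert n1, Finset.sum_insert n2, Finset.sum_insert n3]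
  rw [hsum] at h1
  omega

/-- The edges of `T` with both endpoints in `S`. -/
def inner (S : Finset Pt) (T : Finset (Sym2 Pt)) : Finset (Sym2 Pt) :=
  T.filter fun e => ∀ x ∈ e, x ∈ S

lemma Frame.card_inner_le (h : Frame o₁ o₂ o₃ S) (hT : Triang (framed o₁ o₂ o₃ S) T) :
    (inner S T).card ≤ 3 * S.card := by
  have h2 := Frame.card_le _ rfl h hT
  obtain ⟨h12, h13, h23⟩ := h.corner_ne
  obtain ⟨e1, e2, e3⟩ := h.outer_mem hT
  have hc : ({s(o₁, o₂), s(o₂, o₃), s(o₃, o₁)} : Finset (Sym2 Pt)).card = 3 := by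
    refine Finset.card_eq_three.2 ⟨_, _, _, ?_, ?_, ?_, rfl⟩ <;>
      simp [h12, h13, h23, h12.symm, h13.symm]
  have hd : Disjoint (inner S T) {s(o₁, o₂), s(o₂, o₃), s(o₃, o₁)} := by
    rw [Finset.disjoint_left]
    intro e he hm
    have he := (Finset.mem_filter.1 he).2
    simp only [Finset.mem_insert, Finset.mem_singleton] at hm
    rcases hm with rfl | rfl | rfl
    · exact (h.ne_of_mem (he o₁ (by simp))).1 rfl
    · exact (h.ne_of_mem (he o₂ (by simp))).2.1 rfl
    · exact (h.ne_of_mem (he o₃ (by simp))).2.2 rfl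
  have hu : (inner S T) ∪ {s(o₁, o₂), s(o₂, o₃), s(o₃, o₁)} ⊆ T := by
    refine Finset.union_subset (Finset.filter_subset _ _) ?_
    intro e hm
    simp only [Finset.mem_insert, Finset.mem_singleton] at hm
    rcases hm with rfl | rfl | rfl <;> assumption
  have := Finset.card_le_card hu
  rw [Finset.card_union_of_disjoint hd, hc] at this
  omega

/-- All triangulations of `P`. -/
def triangs (P : Finset Pt) : Finset (Finset (Sym2 Pt)) := P.sym2.powerset.filter (Triang P)

lemma mem_triangs : T ∈ triangs P ↔ Triang P T := by
  rw [triangs, Finset.mem_filter, Finset.mem_powerset, and_iff_right_iff_imp]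
  intro h e he
  induction e with
  | _ a b => exact Finset.mk_mem_sym2_iff.2 ⟨h.left_mem he, h.right_mem he⟩

/-- The triangulations of `P` in which `p` has degree `k`. -/
def triangsDeg (P : Finset Pt) (p : Pt) (k : ℕ) : Finset (Finset (Sym2 Pt)) :=
  (triangs P).filter fun T => (nb P T p).card = k

lemma mem_triangsDeg {p : Pt} {k : ℕ} :
    T ∈ triangsDeg P p k ↔ Triang P T ∧ (nb P T p).card = k := by
  rw [triangsDeg, Finset.mem_filter, mem_triangs]

lemma card_triangsDeg_succ_le (gp : Generic P) {p : Pt} (hp : p ∈ P) (hs : Surrounded P p)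
    {k : ℕ} (hk : 3 ≤ k) :
    (triangsDeg P p (k + 1)).card ≤ k.choose 2 * (triangsDeg P p k).card := by
  have hflip : ∀ T : Finset (Sym2 Pt), T ∈ triangsDeg P p (k + 1) →
      ∃ x : (_ : Finset (Sym2 Pt)) × Sym2 Pt, x ∈ (triangsDeg P p k).sigma
        (fun T' => (nb P T' p).offDiag.image fun y => s(y.1, y.2)) ∧
        ∃ q ∈ nb P T p, x.2 ∉ T ∧ x.1 = insert x.2 (T.erase s(p, q)) := by
    intro T hT
    rw [mem_triangsDeg] at hT
    obtain ⟨T', e, q, hT', hq, hnb, h1, he, hmem⟩ := hT.1.exists_flip gp hp hs (by omega)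
    refine ⟨⟨T', e⟩, ?_, q, hq, he, h1⟩
    rw [Finset.mem_sigma]
    refine ⟨mem_triangsDeg.2 ⟨hT', ?_⟩, hmem⟩
    rw [hnb, Finset.card_erase_of_mem hq, hT.2]
    rfl
  choose! f hf using hflip
  refine (Finset.card_le_card_of_injOn f (fun T hT => (hf T hT).1) ?_).trans ?_
  · intro T hT T' hT' h
    obtain ⟨-, q, hq, he, h1⟩ := hf T hT
    obtain ⟨-, q', hq', he', h1'⟩ := hf T' hT'
    rw [← h] at he' h1'
    exact (mem_triangsDeg.1 hT).1.flip_injective (mem_triangsDeg.1 hT').1 hp hq hq' he he'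
      (h1.symm.trans h1')
  · rw [Finset.card_sigma, mul_comm, ← smul_eq_mul]
    refine Finset.sum_le_card_nsmul _ _ _ fun T hT => ?_
    rw [← (mem_triangsDeg.1 hT).2, ← Sym2.card_image_offDiag]
    rfl

lemma card_triangsDeg_three_le (gp : Generic P) {p : Pt} (hp : p ∈ P) (hs : Surrounded P p) :
    (triangsDeg P p 3).card ≤ (triangs (P.erase p)).card := by
  refine Finset.card_le_card_of_injOn (fun T => del T p) ?_ ?_
  · intro T hT
    have hT := mem_triangsDeg.1 hT
    exact mem_triangs.2 (hT.1.triang_del gp hp hs hT.2)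
  · intro T hT T' hT' h
    exact (mem_triangsDeg.1 hT).1.del_injective (mem_triangsDeg.1 hT').1 h

lemma sum_seven_sub_degree_le (gp : Generic P) {p : Pt} (hp : p ∈ P) (hs : Surrounded P p) :
    ∑ T ∈ triangs P, (7 - (nb P T p).card) ≤ 229 * (triangs (P.erase p)).card := by
  have h3 := card_triangsDeg_three_le gp hp hs
  have h4 := card_triangsDeg_succ_le gp hp hs (k := 3) le_rfl
  have h5 := card_triangsDeg_succ_le gp hp hs (k := 4) (by norm_num)
  have h6 := card_triangsDeg_succ_le gp hp hs (k := 5) (by norm_num)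
  norm_num [Nat.choose] at h4 h5 h6
  have e : ∑ T ∈ triangs P, (7 - (nb P T p).card) ≤ 4 * (triangsDeg P p 3).card
      + 3 * (triangsDeg P p 4).card + 2 * (triangsDeg P p 5).card + (triangsDeg P p 6).card := by
    simp only [triangsDeg, Finset.card_filter, Finset.mul_sum, ← Finset.sum_add_distrib]
    refine Finset.sum_le_sum fun T hT => ?_
    have := (mem_triangs.1 hT).three_le_degree gp hp hs
    split_ifs <;> omega
  omega

/-- The number of triangulations of `n` points in a triangular frame is at most `229 ^ n`. -/
lemma Frame.card_triangs_le (n : ℕ) : ∀ {S : Finset Pt}, S.card = n → Frame o₁ o₂ o₃ S →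
    (triangs (framed o₁ o₂ o₃ S)).card ≤ 229 ^ n := by
  induction n with
  | zero =>
    intro S hS h
    rw [Finset.card_eq_zero] at hS
    subst hS
    rw [pow_zero, Finset.card_le_one]
    have key : ∀ {T T' : Finset (Sym2 Pt)}, Triang (framed o₁ o₂ o₃ ∅) T →
        Triang (framed o₁ o₂ o₃ ∅) T' → T ⊆ T' := by
      intro T T' hT hT' e he
      obtain ⟨e1, e2, e3⟩ := h.outer_mem hT'
      induction e with
      | _ a b =>
      have ha := mem_framed.1 (hT.left_mem he)
      have hb := mem_framed.1 (hT.right_mem he)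
      have hab := hT.ne he
      simp only [Finset.notMem_empty, or_false] at ha hb
      have e1' : s(o₂, o₁) ∈ T' := Sym2.eq_swap ▸ e1
      have e2' : s(o₃, o₂) ∈ T' := Sym2.eq_swap ▸ e2
      have e3' : s(o₁, o₃) ∈ T' := Sym2.eq_swap ▸ e3
      grind
    intro T hT T' hT'
    rw [mem_triangs] at hT hT'
    exact (key hT hT').antisymm (key hT' hT)
  | succ n ih =>
    intro S hS h
    have hP : ∀ p ∈ S, p ∈ framed o₁ o₂ o₃ S := fun p hp => mem_framed.2 (by tauto)
    have h1 : ∀ T ∈ triangs (framed o₁ o₂ o₃ S),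
        S.card ≤ ∑ p ∈ S, (7 - (nb (framed o₁ o₂ o₃ S) T p).card) := by
      intro T hT
      have h2 := h.sum_degree_le (mem_triangs.1 hT)
      have h3 : ∑ p ∈ S, 7 ≤ ∑ p ∈ S, ((7 - (nb (framed o₁ o₂ o₃ S) T p).card)
          + (nb (framed o₁ o₂ o₃ S) T p).card) := Finset.sum_le_sum fun p _ => by omega
      rw [Finset.sum_const, smul_eq_mul, Finset.sum_add_distrib] at h3
      omega
    have h2 := Finset.card_nsmul_le_sum _ _ _ h1
    rw [Finset.sum_comm, smul_eq_mul] at h2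
    have h3 := Finset.sum_le_card_nsmul S (fun p => ∑ T ∈ triangs (framed o₁ o₂ o₃ S),
      (7 - (nb (framed o₁ o₂ o₃ S) T p).card)) (229 * 229 ^ n) (fun p hp => by
        refine (sum_seven_sub_degree_le h.generic (hP p hp) (h.surrounded hp)).trans ?_
        refine Nat.mul_le_mul_left _ ?_
        have h4 := ih (by rw [Finset.card_erase_of_mem hp]; omega) (h.erase p)
        rw [← h.framed_erase hp] at h4
        exact h4)
    have h4 := h2.trans h3
    rw [smul_eq_mul, mul_comm, hS] at h4
    rw [pow_succ']
    exact Nat.le_of_mul_le_mul_left h4 n.succ_pos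

lemma Plane.exists_triang (hG : Plane P G) : ∃ T, G ⊆ T ∧ Triang P T := by
  have hsub : ∀ {H : Finset (Sym2 Pt)}, Plane P H → H ⊆ P.sym2 := by
    intro H hH e he
    induction e with
    | _ a b => exact Finset.mk_mem_sym2_iff.2 ⟨hH.left_mem he, hH.right_mem he⟩
  obtain ⟨T, hT, hmax⟩ := Finset.exists_max_image
    (P.sym2.powerset.filter fun H => Plane P H ∧ G ⊆ H) Finset.card
    ⟨G, by simp [hG, hsub hG]⟩
  simp only [Finset.mem_filter, Finset.mem_powerset] at hT hmax
  refine ⟨T, hT.2.2, hT.2.1, fun {a b} ha hb hab hX => ?_⟩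
  by_contra hn
  have hpl := hT.2.1.insert_edge ha hb hab hX
  have := hmax _ ⟨hsub hpl, hpl, hT.2.2.trans (Finset.subset_insert _ _)⟩
  rw [Finset.card_insert_of_notMem hn] at this
  omega

lemma mem_openSegment_lin {t : ℝ} (h0 : 0 < t) (h1 : t < 1) (a b : Pt) :
    lin t a b ∈ openSegment ℝ a b :=
  ⟨1 - t, t, by linarith, h0, by ring, by ext <;> simp [lin]⟩

lemma IsPlaneGraph.plane (hG : IsPlaneGraph S G) (hP : S ⊆ P) : Plane P G := by
  refine ⟨fun h => ?_, fun h => ?_, fun {a b c d} h h' hX => ?_⟩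
  · simpa using (hG.1 _ h).1
  · exact hP ((hG.1 _ h).2 _ (Sym2.mem_mk_left _ _))
  · obtain ⟨s, t, hs0, hs1, ht0, ht1, he⟩ := hX.exists_point
    refine hG.2 _ h _ h' (fun e => not_crosses_self a b (hX.congr_right e.symm))
      ⟨a, b, c, d, rfl, rfl, lin s a b, mem_openSegment_lin hs0 hs1 a b, ?_⟩
    rw [he]
    exact mem_openSegment_lin ht0 ht1 c d

lemma Frame.card_planeGraphs_le (h : Frame o₁ o₂ o₃ S) :
    (planeGraphs S).card ≤ 1832 ^ S.card := by
  have hS : S ⊆ framed o₁ o₂ o₃ S := fun p hp => mem_framed.2 (by tauto)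
  have hsub : planeGraphs S ⊆
      (triangs (framed o₁ o₂ o₃ S)).biUnion fun T => (inner S T).powerset := by
    intro G hG
    have hG := (Finset.mem_filter.1 hG).2
    obtain ⟨T, hGT, hT⟩ := (hG.plane hS).exists_triang
    rw [Finset.mem_biUnion]
    refine ⟨T, mem_triangs.2 hT, Finset.mem_powerset.2 fun e he => ?_⟩
    exact Finset.mem_filter.2 ⟨hGT he, (hG.1 e he).2⟩
  refine (Finset.card_le_card hsub).trans ((Finset.card_biUnion_le_card_mul _ _ (8 ^ S.card)
    fun T hT => ?_).trans ?_)
  · rw [Finset.card_powerset, show 8 = 2 ^ 3 by norm_num, ← pow_mul]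
    exact Nat.pow_le_pow_right (by norm_num) (h.card_inner_le (mem_triangs.1 hT))
  · rw [show 1832 = 229 * 8 by norm_num, mul_pow]
    exact Nat.mul_le_mul_right _ (Frame.card_triangs_le _ rfl h)

lemma GenPos.generic (h : GenPos S) : Generic S := by
  intro p hp q hq r hr hpq hpr hqr h0
  obtain ⟨t, ht⟩ := exists_lin_of_orient_eq_zero hpq h0
  refine h p hp q hq r hr hpq hpr hqr ?_
  rw [collinear_iff_of_mem (p₀ := p) (by simp)]
  refine ⟨q - p, fun x hx => ?_⟩
  simp only [Set.mem_insert_iff, Set.mem_singleton_iff] at hx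
  rcases hx with rfl | rfl | rfl
  · exact ⟨0, by simp⟩
  · exact ⟨1, by simp⟩
  · refine ⟨t, ht.trans ?_⟩
    ext <;> simp [lin] <;> ring

lemma Generic.insert (gp : Generic P) {o : Pt}
    (h : ∀ a ∈ P, ∀ b ∈ P, a ≠ b → orient a b o ≠ 0) : Generic (insert o P) := by
  intro p hp q hq r hr hpq hpr hqr
  rw [Finset.mem_insert] at hp hq hr
  rcases hp with rfl | hp <;> rcases hq with rfl | hq <;> rcases hr with rfl | hr
  · exact absurd rfl hpq
  · exact absurd rfl hpq
  · exact absurd rfl hpr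
  · rw [← orient_rot]; exact h q hq r hr hqr
  · exact absurd rfl hqr
  · rw [orient_swap, neg_ne_zero]; exact h p hp r hr hpr
  · exact h p hp q hq hpq
  · exact gp p hp q hq r hr hpq hpr hqr

/-- Every unit square contains a point on none of the lines spanned by `P`. -/
lemma exists_generic_point (P : Finset Pt) (x y : ℝ) : ∃ o : Pt, x < o.1 ∧ o.1 < x + 1 ∧
    y < o.2 ∧ o.2 < y + 1 ∧ ∀ a ∈ P, ∀ b ∈ P, a ≠ b → orient a b o ≠ 0 := by
  have fin : ∀ a b : Pt, a ≠ b → {s : ℝ | orient a b (x + s, y + s ^ 2) = 0}.Finite := by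
    intro a b hab
    rcases Set.eq_empty_or_nonempty {s : ℝ | orient a b (x + s, y + s ^ 2) = 0} with h | ⟨r, hr⟩
    · rw [h]; exact Set.finite_empty
    refine (Set.toFinite {r, (b.2 - a.2) / (b.1 - a.1) - r}).subset fun s hs => ?_
    simp only [Set.mem_ofPred_eq, orient] at hs hr
    have e : (s - r) * ((b.1 - a.1) * (s + r) - (b.2 - a.2)) = 0 := by linear_combination hs - hr
    rcases mul_eq_zero.1 e with h | h
    · exact Or.inl (by linarith)
    by_cases h1 : b.1 - a.1 = 0
    · rw [h1, zero_mul, zero_sub, neg_eq_zero] at h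
      exact absurd (Prod.ext (by linarith) (by linarith)) hab
    · right
      rw [Set.mem_singleton_iff, eq_sub_iff_add_eq, eq_div_iff h1]
      linarith
  have hfin : (⋃ c ∈ P.offDiag, {s : ℝ | orient c.1 c.2 (x + s, y + s ^ 2) = 0}).Finite :=
    P.offDiag.finite_toSet.biUnion fun c hc => fin _ _ (Finset.mem_offDiag.1 hc).2.2
  obtain ⟨s, ⟨h0, h1⟩, hs⟩ := (Set.Ioo_infinite (zero_lt_one (α := ℝ))).exists_notMem_finite hfin
  refine ⟨(x + s, y + s ^ 2), by simp [h0], by simp [h1], by simp [pow_pos h0], ?_, ?_⟩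
  · simpa using pow_lt_one₀ h0.le h1 two_ne_zero
  · intro a ha b hb hab h
    exact hs (Set.mem_biUnion (x := (a, b)) (Finset.mem_offDiag.2 ⟨ha, hb, hab⟩) h)

lemma exists_frame (gp : Generic S) : ∃ o₁ o₂ o₃, Frame o₁ o₂ o₃ S := by
  obtain ⟨M, hM1, hM⟩ : ∃ M : ℝ, 1 ≤ M ∧ ∀ p ∈ S, |p.1| ≤ M ∧ |p.2| ≤ M := by
    refine ⟨1 + ∑ p ∈ S, (|p.1| + |p.2|), ?_, fun p hp => ?_⟩
    · have : 0 ≤ ∑ p ∈ S, (|p.1| + |p.2|) := Finset.sum_nonneg fun p _ => by positivity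
      linarith
    · have := Finset.single_le_sum (f := fun p : Pt => |p.1| + |p.2|)
        (fun p _ => by positivity) hp
      constructor <;> linarith [abs_nonneg p.1, abs_nonneg p.2]
  obtain ⟨o₃, c1, c2, c3, c4, h3⟩ := exists_generic_point S (-4 * M) (12 * M)
  obtain ⟨o₂, b1, b2, b3, b4, h2⟩ := exists_generic_point (insert o₃ S) (12 * M) (-4 * M)
  obtain ⟨o₁, a1, a2, a3, a4, h1⟩ :=
    exists_generic_point (insert o₂ (insert o₃ S)) (-4 * M) (-4 * M)
  have key : ∀ {A B U V : ℝ}, A ≤ M → 0 ≤ V → V ≤ 14 * M → 15 * M ≤ B → 2 * M ≤ U →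
      0 < B * U - A * V := by
    intro A B U V hA hV0 hV hB hU
    have k1 : 15 * M * (2 * M) ≤ B * U := mul_le_mul hB hU (by linarith) (by linarith)
    have k2 : A * V ≤ M * V := mul_le_mul_of_nonneg_right hA hV0
    have k3 : M * V ≤ M * (14 * M) := mul_le_mul_of_nonneg_left hV (by linarith)
    nlinarith
  have key' : ∀ {A B U V : ℝ}, 0 ≤ V → V ≤ 6 * M → A ≤ 17 * M → 15 * M ≤ B → 11 * M ≤ U →
      0 < B * U - A * V := by
    intro A B U V hV0 hV hA hB hU
    have k1 : 15 * M * (11 * M) ≤ B * U := mul_le_mul hB hU (by linarith) (by linarith)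
    have k2 : A * V ≤ 17 * M * V := mul_le_mul_of_nonneg_right hA hV0
    have k3 : 17 * M * V ≤ 17 * M * (6 * M) := mul_le_mul_of_nonneg_left hV (by linarith)
    nlinarith
  have inside : ∀ p : Pt, |p.1| ≤ M → |p.2| ≤ M → Inside o₁ o₂ o₃ p := by
    intro p hp1 hp2
    rw [abs_le] at hp1 hp2
    obtain ⟨p1, p2⟩ := hp1
    obtain ⟨p3, p4⟩ := hp2
    refine ⟨?_, ?_, ?_⟩
    · exact key (by linarith) (by linarith) (by linarith) (by linarith) (by linarith)
    · have := key' (B := o₃.2 - o₂.2) (U := o₂.1 - p.1) (A := o₂.1 - o₃.1) (V := p.2 - o₂.2)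
        (by linarith) (by linarith) (by linarith) (by linarith) (by linarith)
      simp only [orient]; linarith
    · have := key (B := o₃.2 - o₁.2) (U := p.1 - o₃.1) (A := o₁.1 - o₃.1) (V := o₃.2 - p.2)
        (by linarith) (by linarith) (by linarith) (by linarith) (by linarith)
      simp only [orient]; linarith
  refine ⟨o₁, o₂, o₃, ((gp.insert h3).insert h2).insert h1, ?_, fun p hp =>
    inside p (hM p hp).1 (hM p hp).2⟩
  exact (inside 0 (by simp; linarith) (by simp; linarith)).orient_pos

end Triangulations

/-- Theorem 2.5. The number of plane graphs on any set of `N ≥ 1`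
points in general position is at most `3207.42 ^ N`. -/
theorem stmt4 (N : ℕ) (hN : 1 ≤ N) (S : Finset Pt) (hS : S.card = N)
    (hgp : GenPos S) :
    ((planeGraphs S).card : ℝ) ≤ 3207.42 ^ N := by
  obtain ⟨o₁, o₂, o₃, h⟩ := exists_frame hgp.generic
  have h1 : ((planeGraphs S).card : ℝ) ≤ 1832 ^ N := by
    rw [← hS]; exact_mod_cast h.card_planeGraphs_le
  exact h1.trans (pow_le_pow_left₀ (by norm_num) (by norm_num) N)
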